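/- arXiv:0908.3973 — 2 statements merged into one kernel-verified Lean document; each statement's English description precedes it below -/
import Mathlib

section
/- Davenport–Schmidt theorem on uniform simultaneous approximation to a number and its square: Let ξ be a real number which is neither rational nor a quadratic irrational, and let γ = (1+√5)/2. Then there exists a constant c > 0 such that for arbitrarily large positive integers N (i.e., for an unbounded set of N) the system of inequalities max{|x₁ − x₀ξ|, |x₂ − x₀ξ²|} ≤ c·N^{−1/γ} and |x₀| ≤ N has no solution in integer triples (x₀, x₁, x₂) ∈ ℤ³ \ {(0,0,0)}. -/
/-- A real function on the positive integers without minimum has an infinite sequence of records. -/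
theorem exists_record_sequence (f : ℕ → ℝ) (hf : ∀ q, 0 < q → ∃ n, 0 < n ∧ f n < f q) :
    ∃ q : ℕ → ℕ, StrictMono q ∧ (∀ i, 0 < q i) ∧ (∀ i, f (q (i + 1)) < f (q i)) ∧
      ∀ i n, 0 < n → n < q (i + 1) → f (q i) ≤ f n := by
  classical
  have hnext : ∀ q, ∃ r, 0 < q → 0 < r ∧ f r < f q ∧ ∀ n, 0 < n → f n < f q → r ≤ n := by
    intro q
    by_cases hq : 0 < q
    · have h := hf q hq
      exact ⟨Nat.find h, fun _ ↦ ⟨(Nat.find_spec h).1, (Nat.find_spec h).2,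
        fun n hn hlt ↦ Nat.find_min' h ⟨hn, hlt⟩⟩⟩
    · exact ⟨0, fun h ↦ absurd h hq⟩
  choose g hg using hnext
  let q : ℕ → ℕ := fun i ↦ Nat.rec 1 (fun _ r ↦ g r) i
  have hsucc : ∀ i, q (i + 1) = g (q i) := fun _ ↦ rfl
  have hpos : ∀ i, 0 < q i := by
    intro i
    induction i with
    | zero => exact Nat.one_pos
    | succ i ih => exact hsucc i ▸ (hg _ ih).1
  have hlt : ∀ i, f (q (i + 1)) < f (q i) := fun i ↦ hsucc i ▸ (hg _ (hpos i)).2.1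
  have hmin : ∀ i n, 0 < n → f n < f (q i) → q (i + 1) ≤ n :=
    fun i ↦ hsucc i ▸ (hg _ (hpos i)).2.2
  refine ⟨q, strictMono_nat_of_lt_succ fun i ↦ ?_, hpos, hlt, fun i n hn hni ↦ ?_⟩
  · refine lt_of_le_of_ne ?_ fun h ↦ (hlt i).ne (by rw [← h])
    cases i with
    | zero => exact hpos 1
    | succ i => exact hmin i _ (hpos (i + 2)) ((hlt (i + 1)).trans (hlt i))
  · by_contra! h
    exact absurd (hmin i n hn h) (by omega)

theorem one_le_abs_intCast {n : ℤ} (hn : n ≠ 0) : (1 : ℝ) ≤ |(n : ℝ)| := by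
  exact_mod_cast Int.one_le_abs hn

/-- A lower bound for the quality of approximation when `x₀ x₂ - x₁ ^ 2` does not vanish. -/
theorem one_le_of_disc_ne_zero {ξ L : ℝ} {x₀ x₁ x₂ : ℤ} (hx₀ : 1 ≤ x₀)
    (h₁ : |(x₁ : ℝ) - x₀ * ξ| ≤ L) (h₂ : |(x₂ : ℝ) - x₀ * ξ ^ 2| ≤ L) (hL : L ≤ 1)
    (hne : x₀ * x₂ ≠ x₁ ^ 2) : 1 ≤ (2 + 2 * |ξ|) * x₀ * L := by
  have hx : (1 : ℝ) ≤ x₀ := by exact_mod_cast hx₀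
  have hL0 : 0 ≤ L := (abs_nonneg _).trans h₁
  have h := one_le_abs_intCast (sub_ne_zero.2 hne)
  push_cast at h
  set a := (x₁ : ℝ) - x₀ * ξ with ha
  set b := (x₂ : ℝ) - x₀ * ξ ^ 2 with hb
  have e : (x₀ : ℝ) * x₂ - x₁ ^ 2 = x₀ * b - 2 * x₀ * (ξ * a) - a * a := by rw [ha, hb]; ring
  rw [e] at h
  have h3 : |ξ * a| ≤ |ξ| * L := by rw [abs_mul]; gcongr
  have h4 : |a * a| ≤ L * L := by rw [abs_mul]; gcongr
  have h5 : |(x₀ : ℝ) * b| ≤ x₀ * L := by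
    rw [abs_mul, abs_of_pos (by linarith : (0 : ℝ) < x₀)]; gcongr
  have h6 : |2 * (x₀ : ℝ) * (ξ * a)| ≤ 2 * x₀ * (|ξ| * L) := by
    rw [abs_mul, abs_of_pos (by linarith : (0 : ℝ) < 2 * x₀)]; gcongr
  have h7 := abs_sub (x₀ * b - 2 * x₀ * (ξ * a)) (a * a)
  have h8 := abs_sub (x₀ * b) (2 * x₀ * (ξ * a))
  have h9 : L * L ≤ x₀ * L := by gcongr; linarith
  nlinarith

/-- Integer points on the cone `x₀ x₂ = x₁ ^ 2`. -/
theorem exists_param_of_mul_eq_sq {x₀ x₁ x₂ : ℤ} (hx₀ : 1 ≤ x₀) (h : x₀ * x₂ = x₁ ^ 2) :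
    ∃ k m n : ℤ, 1 ≤ k ∧ 1 ≤ m ∧ x₀ = k * m ^ 2 ∧ x₁ = k * m * n ∧ x₂ = k * n ^ 2 := by
  have hg : 0 < Int.gcd x₀ x₁ := Int.gcd_pos_of_ne_zero_left _ (by omega)
  obtain ⟨m, n, hmn, hm, hn⟩ := Int.exists_gcd_one hg
  have hg' : (0 : ℤ) < Int.gcd x₀ x₁ := by exact_mod_cast hg
  generalize (Int.gcd x₀ x₁ : ℤ) = g at *
  have hmpos : 0 < m := by
    by_contra! hcon
    nlinarith
  have e : m * x₂ = g * n ^ 2 := by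
    have : g * (m * x₂) = g * (g * n ^ 2) := by rw [hm, hn] at h; linear_combination h
    exact mul_left_cancel₀ hg'.ne' this
  have hcop : IsCoprime m (n ^ 2) := (Int.isCoprime_iff_gcd_eq_one.2 hmn).pow_right
  obtain ⟨k, rfl⟩ := hcop.dvd_of_dvd_mul_right (Dvd.intro _ e)
  refine ⟨k, m, n, ?_, hmpos, by rw [hm]; ring, by rw [hn]; ring, ?_⟩
  · by_contra! hcon
    nlinarith
  · exact mul_left_cancel₀ hmpos.ne' (by linear_combination e)

/-- A lower bound for the quality of approximation when `x₀ x₂ - x₁ ^ 2` vanishes, in terms of a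
non-proportional point `y` of smaller height. -/
theorem one_le_of_disc_eq_zero {ξ L M : ℝ} {x₀ x₁ x₂ y₀ y₁ y₂ : ℤ} (hy₀ : 1 ≤ y₀) (hyx : y₀ ≤ x₀)
    (hx₁ : |(x₁ : ℝ) - x₀ * ξ| ≤ L)
    (hy₁ : |(y₁ : ℝ) - y₀ * ξ| ≤ M) (hy₂ : |(y₂ : ℝ) - y₀ * ξ ^ 2| ≤ M)
    (hLM : L ≤ M) (hM : M ≤ 1) (hdisc : x₀ * x₂ = x₁ ^ 2)
    (hne : ¬ (y₀ * x₁ = x₀ * y₁ ∧ y₀ * x₂ = x₀ * y₂)) :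
    1 ≤ (2 + 2 * |ξ|) ^ 2 * x₀ * M ^ 2 := by
  obtain ⟨k, m, n, hk, hm, rfl, rfl, rfl⟩ := exists_param_of_mul_eq_sq (hy₀.trans hyx) hdisc
  have hM0 : 0 ≤ M := (abs_nonneg _).trans hy₁
  have hkR : (1 : ℝ) ≤ k := by exact_mod_cast hk
  have hmR : (1 : ℝ) ≤ m := by exact_mod_cast hm
  have hyR : (1 : ℝ) ≤ y₀ := by exact_mod_cast hy₀
  have hyxR : (y₀ : ℝ) ≤ k * m ^ 2 := by exact_mod_cast hyx
  push_cast at hx₁ ⊢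
  set d := (n : ℝ) - m * ξ with hd
  set a := (y₁ : ℝ) - y₀ * ξ with ha
  set b := (y₂ : ℝ) - y₀ * ξ ^ 2 with hb
  have hkm : (1 : ℝ) ≤ k * m := by nlinarith
  have hd1 : k * m * |d| ≤ M := by
    have : (k : ℝ) * m * n - k * m ^ 2 * ξ = k * m * d := by rw [hd]; ring
    rw [this, abs_mul, abs_of_pos (by linarith)] at hx₁
    exact hx₁.trans hLM
  have hdM : |d| ≤ M := by nlinarith [abs_nonneg d]
  have hyd : y₀ * |d| ≤ m * M := by
    calc y₀ * |d| ≤ k * m ^ 2 * |d| := by gcongr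
      _ = m * (k * m * |d|) := by ring
      _ ≤ m * M := by gcongr
  have hyd' : |y₀ * d| ≤ m * M := by
    rwa [abs_mul, abs_of_pos (by linarith : (0 : ℝ) < y₀)]
  have hma : |m * a| ≤ m * M := by
    rw [abs_mul, abs_of_pos (by linarith : (0 : ℝ) < m)]; gcongr
  have hmb : |m * b| ≤ m * M := by
    rw [abs_mul, abs_of_pos (by linarith : (0 : ℝ) < m)]; gcongr
  have hmM : 0 ≤ m * M := by positivity
  have hmain : 1 ≤ (2 + 2 * |ξ|) * (m * M) := by
    by_cases hu : y₀ * n - y₁ * m = 0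
    · by_cases hv : y₁ * n - y₂ * m = 0
      · refine absurd ⟨?_, ?_⟩ hne
        · linear_combination k * m * hu
        · linear_combination k * n * hu + k * m * hv
      · have h := one_le_abs_intCast hv
        push_cast at h
        have e : (y₁ : ℝ) * n - y₂ * m = ξ * (y₀ * d) + a * d - m * b + ξ * (m * a) := by
          rw [hd, ha, hb]; ring
        rw [e] at h
        have h1 : |ξ * (y₀ * d)| ≤ |ξ| * (m * M) := by rw [abs_mul]; gcongr
        have h2 : |ξ * (m * a)| ≤ |ξ| * (m * M) := by rw [abs_mul]; gcongr
        have h3 : |a * d| ≤ m * M := by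
          rw [abs_mul]
          calc |a| * |d| ≤ 1 * M := by gcongr; linarith
            _ ≤ m * M := by gcongr
        have t1 := abs_add_le (ξ * (y₀ * d) + a * d - m * b) (ξ * (m * a))
        have t2 := abs_sub (ξ * (y₀ * d) + a * d) (m * b)
        have t3 := abs_add_le (ξ * (y₀ * d)) (a * d)
        linarith
    · have h := one_le_abs_intCast hu
      push_cast at h
      have e : (y₀ : ℝ) * n - y₁ * m = y₀ * d - m * a := by rw [hd, ha]; ring
      rw [e] at h
      have t := abs_sub (y₀ * d) (m * a)
      nlinarith [abs_nonneg ξ]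
  calc (1 : ℝ) ≤ ((2 + 2 * |ξ|) * (m * M)) ^ 2 := one_le_pow₀ hmain
    _ = 1 * ((2 + 2 * |ξ|) ^ 2 * m ^ 2 * M ^ 2) := by ring
    _ ≤ k * ((2 + 2 * |ξ|) ^ 2 * m ^ 2 * M ^ 2) := by gcongr
    _ = (2 + 2 * |ξ|) ^ 2 * (k * m ^ 2) * M ^ 2 := by ring

/-- The determinant of three integer points given by their coordinates. -/
def tripleDet (x₀ x₁ x₂ y₀ y₁ y₂ z₀ z₁ z₂ : ℤ) : ℤ :=
  (x₁ * y₂ - x₂ * y₁) * z₀ + (x₂ * y₀ - x₀ * y₂) * z₁ + (x₀ * y₁ - x₁ * y₀) * z₂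

theorem one_le_of_tripleDet_ne_zero {ξ L M R : ℝ} {x₀ x₁ x₂ y₀ y₁ y₂ z₀ z₁ z₂ : ℤ}
    (hx₀ : 1 ≤ x₀) (hxy : x₀ ≤ y₀) (hyz : y₀ ≤ z₀)
    (hx₁ : |(x₁ : ℝ) - x₀ * ξ| ≤ L) (hx₂ : |(x₂ : ℝ) - x₀ * ξ ^ 2| ≤ L)
    (hy₁ : |(y₁ : ℝ) - y₀ * ξ| ≤ M) (hy₂ : |(y₂ : ℝ) - y₀ * ξ ^ 2| ≤ M)
    (hz₁ : |(z₁ : ℝ) - z₀ * ξ| ≤ R) (hz₂ : |(z₂ : ℝ) - z₀ * ξ ^ 2| ≤ R)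
    (hML : M ≤ L) (hRM : R ≤ M) (hdet : tripleDet x₀ x₁ x₂ y₀ y₁ y₂ z₀ z₁ z₂ ≠ 0) :
    1 ≤ 6 * (z₀ * M * L) := by
  have hxR : (1 : ℝ) ≤ x₀ := by exact_mod_cast hx₀
  have hxyR : (x₀ : ℝ) ≤ y₀ := by exact_mod_cast hxy
  have hyzR : (y₀ : ℝ) ≤ z₀ := by exact_mod_cast hyz
  have hR0 : 0 ≤ R := (abs_nonneg _).trans hz₁
  have h := one_le_abs_intCast hdet
  unfold tripleDet at h
  push_cast at h
  set a := (x₁ : ℝ) - x₀ * ξ with ha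
  set a' := (x₂ : ℝ) - x₀ * ξ ^ 2 with ha'
  set b := (y₁ : ℝ) - y₀ * ξ with hb
  set b' := (y₂ : ℝ) - y₀ * ξ ^ 2 with hb'
  set c := (z₁ : ℝ) - z₀ * ξ with hc
  set c' := (z₂ : ℝ) - z₀ * ξ ^ 2 with hc'
  have key : ∀ t u v p r : ℝ, 0 ≤ t → t ≤ z₀ → |u| ≤ p → |v| ≤ r → 0 ≤ r → p * r ≤ M * L →
      |t * (u * v)| ≤ z₀ * M * L := by
    intro t u v p r ht htz hu hv hr hpr
    rw [abs_mul, abs_mul, abs_of_nonneg ht, mul_assoc]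
    have : |u| * |v| ≤ M * L := by
      calc |u| * |v| ≤ p * r := mul_le_mul hu hv (abs_nonneg v) ((abs_nonneg u).trans hu)
        _ ≤ _ := hpr
    exact mul_le_mul htz this (by positivity) (ht.trans htz)
  have e : ((x₁ : ℝ) * y₂ - x₂ * y₁) * z₀ + (x₂ * y₀ - x₀ * y₂) * z₁ + (x₀ * y₁ - x₁ * y₀) * z₂ =
      z₀ * (b' * a) - z₀ * (b * a') + y₀ * (c * a') - y₀ * (c' * a) + x₀ * (c' * b)
        - x₀ * (c * b') := by
    rw [ha, ha', hb, hb', hc, hc']; ring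
  rw [e] at h
  have hM0 : 0 ≤ M := hR0.trans hRM
  have hL0 : 0 ≤ L := hM0.trans hML
  have q1 : R * L ≤ M * L := by gcongr
  have q2 : R * M ≤ M * L := by gcongr
  have k1 := key z₀ b' a M L (by linarith) le_rfl hy₂ hx₁ hL0 le_rfl
  have k2 := key z₀ b a' M L (by linarith) le_rfl hy₁ hx₂ hL0 le_rfl
  have k3 := key y₀ c a' R L (by linarith) hyzR hz₁ hx₂ hL0 q1
  have k4 := key y₀ c' a R L (by linarith) hyzR hz₂ hx₁ hL0 q1
  have k5 := key x₀ c' b R M (by linarith) (by linarith) hz₂ hy₁ hM0 q2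
  have k6 := key x₀ c b' R M (by linarith) (by linarith) hz₁ hy₂ hM0 q2
  rw [abs_le] at k1 k2 k3 k4 k5 k6
  rcases abs_cases (z₀ * (b' * a) - z₀ * (b * a') + y₀ * (c * a') - y₀ * (c' * a) + x₀ * (c' * b)
        - x₀ * (c * b')) with h' | h' <;> linarith

/-- A plane containing two non-proportional points contains every point coplanar with them. -/
theorem plane_contains_of_tripleDet_eq_zero {w₀ w₁ w₂ x₀ x₁ x₂ y₀ y₁ y₂ z₀ z₁ z₂ : ℤ}
    (hne : ¬ (x₀ * y₁ = y₀ * x₁ ∧ x₀ * y₂ = y₀ * x₂))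
    (hx : w₀ * x₀ + w₁ * x₁ + w₂ * x₂ = 0) (hy : w₀ * y₀ + w₁ * y₁ + w₂ * y₂ = 0)
    (hdet : tripleDet x₀ x₁ x₂ y₀ y₁ y₂ z₀ z₁ z₂ = 0) :
    w₀ * z₀ + w₁ * z₁ + w₂ * z₂ = 0 := by
  unfold tripleDet at hdet
  by_cases h : x₀ * y₁ = y₀ * x₁
  · have h2 : x₀ * y₂ - y₀ * x₂ ≠ 0 := fun h' ↦ hne ⟨h, by linarith⟩
    refine (mul_eq_zero.1 (?_ : (x₀ * y₂ - y₀ * x₂) * _ = 0)).resolve_left h2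
    linear_combination (-w₁) * hdet + (x₂ * z₀ * (-1) + x₀ * z₂) * hy + (y₂ * z₀ - y₀ * z₂) * hx
  · have h2 : x₀ * y₁ - y₀ * x₁ ≠ 0 := fun h' ↦ h (by linarith)
    refine (mul_eq_zero.1 (?_ : (x₀ * y₁ - y₀ * x₁) * _ = 0)).resolve_left h2
    linear_combination w₂ * hdet + (x₀ * z₁ - x₁ * z₀) * hy + (y₁ * z₀ - y₀ * z₁) * hx

theorem not_uniform_exponent {A B L M K c lam : ℝ} (hlam : 1 / 2 ≤ lam) (hlam' : lam ^ 2 = 1 - lam)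
    (hA : 1 ≤ A) (hB : 1 ≤ B) (hK : 2 ≤ K) (hc : c = 1 / (4 * K)) (hL0 : 0 ≤ L)
    (hL : L ≤ c * A ^ (-lam)) (hM : M ≤ c * B ^ (-lam)) (h1 : 1 ≤ 6 * (B * M * L))
    (h2 : 1 ≤ K * A * M ∨ 1 ≤ K ^ 2 * A * L ^ 2) : False := by
  have hc0 : 0 < c := by rw [hc]; positivity
  have hKc : K * c = 1 / 4 := by rw [hc]; field_simp
  have hc8 : c ≤ 1 / 8 := by nlinarith
  have hA0 : 0 < A := by linarith
  have hB0 : 0 < B := by linarith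
  rcases h2 with h2 | h2
  · have h3 : 1 ≤ 1 / 4 * (A * B ^ (-lam)) := by
      calc 1 ≤ K * A * M := h2
        _ ≤ K * A * (c * B ^ (-lam)) := by gcongr
        _ = K * c * (A * B ^ (-lam)) := by ring
        _ = _ := by rw [hKc]
    have h4 : 1 ≤ A * B ^ (-lam) := by linarith
    have h5 : 1 ≤ A ^ lam * B ^ (-lam ^ 2) := by
      have := Real.one_le_rpow h4 (by linarith : (0 : ℝ) ≤ lam)
      rwa [Real.mul_rpow hA0.le (by positivity), ← Real.rpow_mul hB0.le,
        show -lam * lam = -lam ^ 2 by ring] at this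
    have h6 : 1 ≤ 6 * c ^ 2 * (B ^ (lam ^ 2) * A ^ (-lam)) := by
      calc 1 ≤ 6 * (B * M * L) := h1
        _ ≤ 6 * (B * (c * B ^ (-lam)) * (c * A ^ (-lam))) := by gcongr
        _ = 6 * c ^ 2 * (B * B ^ (-lam) * A ^ (-lam)) := by ring
        _ = _ := by rw [hlam', sub_eq_add_neg, Real.rpow_add hB0, Real.rpow_one]
    have h7 : (A ^ lam * B ^ (-lam ^ 2)) * (B ^ (lam ^ 2) * A ^ (-lam)) = 1 := by
      rw [Real.rpow_neg hA0.le, Real.rpow_neg hB0.le]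
      field_simp
    have h8 : B ^ (lam ^ 2) * A ^ (-lam) ≤ 1 := by
      rw [← h7]
      exact le_mul_of_one_le_left (by positivity) h5
    nlinarith
  · have h3 : A * (A ^ (-lam)) ^ 2 ≤ 1 := by
      have : A * (A ^ (-lam)) ^ 2 = A ^ (1 + -lam * 2) := by
        rw [← Real.rpow_natCast, ← Real.rpow_mul hA0.le, Real.rpow_add hA0, Real.rpow_one]
        norm_num
      rw [this]
      exact Real.rpow_le_one_of_one_le_of_nonpos hA (by linarith)
    have h4 : 1 ≤ (K * c) ^ 2 * (A * (A ^ (-lam)) ^ 2) := by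
      calc 1 ≤ K ^ 2 * A * L ^ 2 := h2
        _ ≤ K ^ 2 * A * (c * A ^ (-lam)) ^ 2 := by gcongr
        _ = _ := by ring
    rw [hKc] at h4
    linarith

theorem int_relation_eq_zero {ξ : ℝ}
    (hξ : ¬ ∃ Q : Polynomial ℚ, Q ≠ 0 ∧ Q.natDegree ≤ 2 ∧ Polynomial.aeval ξ Q = 0)
    {a b c : ℤ} (h : (a : ℝ) + b * ξ + c * ξ ^ 2 = 0) : b = 0 ∧ c = 0 := by
  by_contra hcon
  refine hξ ⟨Polynomial.C (c : ℚ) * Polynomial.X ^ 2 + Polynomial.C (b : ℚ) * Polynomial.X +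
    Polynomial.C (a : ℚ), fun h0 ↦ hcon ⟨?_, ?_⟩, Polynomial.natDegree_quadratic_le, ?_⟩
  · have := congrArg (fun p ↦ Polynomial.coeff p 1) h0
    simpa [Polynomial.coeff_X, Polynomial.coeff_C, Polynomial.coeff_X_pow,
      -map_intCast, -eq_intCast] using this
  · have := congrArg (fun p ↦ Polynomial.coeff p 2) h0
    simpa [Polynomial.coeff_X, Polynomial.coeff_C, Polynomial.coeff_X_pow,
      -map_intCast, -eq_intCast] using this
  · simp
    linarith

/-- The distance from `(qξ, qξ²)` to the nearest integer point. -/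
noncomputable def sqDist (ξ : ℝ) (q : ℕ) : ℝ :=
  max |(round (q * ξ) : ℝ) - q * ξ| |(round (q * ξ ^ 2) : ℝ) - q * ξ ^ 2|

theorem sqDist_le (ξ : ℝ) (q : ℕ) (m n : ℤ) :
    sqDist ξ q ≤ max |(m : ℝ) - q * ξ| |(n : ℝ) - q * ξ ^ 2| := by
  unfold sqDist
  rw [abs_sub_comm, abs_sub_comm _ ((q : ℝ) * ξ ^ 2), abs_sub_comm (m : ℝ), abs_sub_comm (n : ℝ)]
  exact max_le_max (round_le _ _) (round_le _ _)

theorem sqDist_le_one (ξ : ℝ) (q : ℕ) : sqDist ξ q ≤ 1 := by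
  unfold sqDist
  rw [abs_sub_comm, abs_sub_comm _ ((q : ℝ) * ξ ^ 2)]
  exact max_le ((abs_sub_round _).trans (by norm_num)) ((abs_sub_round _).trans (by norm_num))

theorem not_proportional_of_sqDist_lt {ξ : ℝ} {p q : ℕ} (hp : 0 < p) (hpq : p < q)
    (hlt : sqDist ξ q < sqDist ξ p) :
    ¬ ((p : ℤ) * round (q * ξ) = q * round (p * ξ) ∧
      (p : ℤ) * round (q * ξ ^ 2) = q * round (p * ξ ^ 2)) := by
  rintro ⟨h₁, h₂⟩
  have hpR : (0 : ℝ) < p := by exact_mod_cast hp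
  have hpqR : (p : ℝ) < q := by exact_mod_cast hpq
  have h₁' : (p : ℝ) * round (q * ξ) = q * round (p * ξ) := by exact_mod_cast h₁
  have h₂' : (p : ℝ) * round (q * ξ ^ 2) = q * round (p * ξ ^ 2) := by exact_mod_cast h₂
  have key : ∀ m n t : ℝ, p * n = q * m → |m - p * t| ≤ |n - q * t| := by
    intro m n t h
    have e : (p : ℝ) * (n - q * t) = q * (m - p * t) := by linear_combination h
    have e' := congrArg abs e
    rw [abs_mul, abs_mul, abs_of_pos hpR, abs_of_pos (hpR.trans hpqR)] at e'
    nlinarith [abs_nonneg (m - p * t), abs_nonneg (n - q * t)]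
  exact absurd hlt (not_lt.2 (max_le_max (key _ _ _ h₁') (key _ _ _ h₂')))

/-- Records of the approximation function are infinitely often linearly independent three by
three. -/
theorem exists_tripleDet_ne_zero {ξ : ℝ}
    (hξ : ¬ ∃ Q : Polynomial ℚ, Q ≠ 0 ∧ Q.natDegree ≤ 2 ∧ Polynomial.aeval ξ Q = 0)
    {q : ℕ → ℕ} (hq : StrictMono q) (hpos : ∀ i, 0 < q i)
    (hdec : ∀ i, sqDist ξ (q (i + 1)) < sqDist ξ (q i))
    (hlim : Filter.Tendsto (fun i ↦ sqDist ξ (q i)) Filter.atTop (nhds 0)) (k : ℕ) :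
    ∃ i, k ≤ i ∧ tripleDet (q i) (round (q i * ξ)) (round (q i * ξ ^ 2))
      (q (i + 1)) (round (q (i + 1) * ξ)) (round (q (i + 1) * ξ ^ 2))
      (q (i + 2)) (round (q (i + 2) * ξ)) (round (q (i + 2) * ξ ^ 2)) ≠ 0 := by
  by_contra! hcon
  have hnp := fun i ↦ not_proportional_of_sqDist_lt (hpos i) (hq (Nat.lt_succ_self i)) (hdec i)
  obtain ⟨w₀, w₁, w₂, hw, hwk, hwk'⟩ : ∃ w₀ w₁ w₂ : ℤ, ¬ (w₁ = 0 ∧ w₂ = 0) ∧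
      w₀ * q k + w₁ * round (q k * ξ) + w₂ * round (q k * ξ ^ 2) = 0 ∧
      w₀ * q (k + 1) + w₁ * round (q (k + 1) * ξ) + w₂ * round (q (k + 1) * ξ ^ 2) = 0 := by
    refine ⟨round (q k * ξ) * round (q (k + 1) * ξ ^ 2) -
        round (q k * ξ ^ 2) * round (q (k + 1) * ξ),
      round (q k * ξ ^ 2) * q (k + 1) - q k * round (q (k + 1) * ξ ^ 2),
      q k * round (q (k + 1) * ξ) - round (q k * ξ) * q (k + 1),
      fun h ↦ hnp k ⟨?_, ?_⟩, by ring, by ring⟩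
    · linear_combination h.2
    · linear_combination -h.1
  have hall : ∀ j, w₀ * q (k + j) + w₁ * round (q (k + j) * ξ) +
        w₂ * round (q (k + j) * ξ ^ 2) = 0 ∧
      w₀ * q (k + j + 1) + w₁ * round (q (k + j + 1) * ξ) +
        w₂ * round (q (k + j + 1) * ξ ^ 2) = 0 := by
    intro j
    induction j with
    | zero => exact ⟨hwk, hwk'⟩
    | succ j ih =>
      exact ⟨ih.2, plane_contains_of_tripleDet_eq_zero (hnp (k + j)) ih.1 ih.2
        (hcon (k + j) (Nat.le_add_right _ _))⟩
  set s : ℝ := w₀ + w₁ * ξ + w₂ * ξ ^ 2 with hs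
  have hbound : ∀ j, |s| ≤ (|(w₁ : ℝ)| + |(w₂ : ℝ)|) * sqDist ξ (q (k + j)) := by
    intro j
    have hqj : (1 : ℝ) ≤ q (k + j) := by exact_mod_cast hpos (k + j)
    have h := (hall j).1
    have hR : (w₀ : ℝ) * q (k + j) + w₁ * round (q (k + j) * ξ) +
        w₂ * round (q (k + j) * ξ ^ 2) = 0 := by exact_mod_cast h
    have e : (q (k + j) : ℝ) * s = -(w₁ * ((round (q (k + j) * ξ) : ℝ) - q (k + j) * ξ) +
        w₂ * ((round (q (k + j) * ξ ^ 2) : ℝ) - q (k + j) * ξ ^ 2)) := by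
      rw [hs]; linear_combination hR
    calc |s| ≤ q (k + j) * |s| := le_mul_of_one_le_left (abs_nonneg _) hqj
      _ = |(q (k + j) : ℝ) * s| := by rw [abs_mul, Nat.abs_cast]
      _ ≤ |(w₁ : ℝ)| * |(round (q (k + j) * ξ) : ℝ) - q (k + j) * ξ| +
          |(w₂ : ℝ)| * |(round (q (k + j) * ξ ^ 2) : ℝ) - q (k + j) * ξ ^ 2| := by
        rw [e, abs_neg, ← abs_mul, ← abs_mul]; exact abs_add_le _ _
      _ ≤ |(w₁ : ℝ)| * sqDist ξ (q (k + j)) + |(w₂ : ℝ)| * sqDist ξ (q (k + j)) := by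
        gcongr
        · exact le_max_left _ _
        · exact le_max_right _ _
      _ = _ := by ring
  have hlim' : Filter.Tendsto (fun j ↦ (|(w₁ : ℝ)| + |(w₂ : ℝ)|) * sqDist ξ (q (k + j)))
      Filter.atTop (nhds 0) := by
    have h := hlim.comp (Filter.tendsto_add_atTop_nat k)
    simpa [Function.comp_def, add_comm] using h.const_mul (|(w₁ : ℝ)| + |(w₂ : ℝ)|)
  have hs0 : |s| ≤ 0 := ge_of_tendsto' hlim' hbound
  exact hw (int_relation_eq_zero hξ (abs_nonpos_iff.1 hs0))

/-- Davenport–Schmidt theorem on uniform simultaneous approximation to a number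
and its square, with `γ = (1+√5)/2` the Golden Ratio. -/
theorem davenport_schmidt_uniform (ξ : ℝ)
    (hξ : ¬ ∃ Q : Polynomial ℚ, Q ≠ 0 ∧ Q.natDegree ≤ 2 ∧ Polynomial.aeval ξ Q = 0) :
    ∃ c : ℝ, 0 < c ∧ ∀ N₀ : ℕ, ∃ N : ℕ, N₀ ≤ N ∧
      ∀ x₀ x₁ x₂ : ℤ, (x₀, x₁, x₂) ≠ (0, 0, 0) →
        ¬ (max |(x₁ : ℝ) - (x₀ : ℝ) * ξ| |(x₂ : ℝ) - (x₀ : ℝ) * ξ ^ 2| ≤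
              c * (N : ℝ) ^ (-(1 / ((1 + Real.sqrt 5) / 2))) ∧
            |(x₀ : ℝ)| ≤ (N : ℝ)) := by
  set lam : ℝ := 1 / ((1 + Real.sqrt 5) / 2) with hlam_def
  have hsq : Real.sqrt 5 ^ 2 = 5 := Real.sq_sqrt (by norm_num)
  have hs0 : 0 ≤ Real.sqrt 5 := Real.sqrt_nonneg 5
  have hlam : lam = (Real.sqrt 5 - 1) / 2 := by
    rw [hlam_def]; field_simp; linear_combination -hsq
  have hlam_half : 1 / 2 ≤ lam := by rw [hlam]; nlinarith
  have hlam_one : lam ≤ 1 := by rw [hlam]; nlinarith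
  have hlam_sq : lam ^ 2 = 1 - lam := by rw [hlam]; linear_combination hsq / 4
  clear_value lam
  obtain ⟨K, hK⟩ : ∃ K, K = 2 + 2 * |ξ| := ⟨_, rfl⟩
  have hK2 : 2 ≤ K := by rw [hK]; linarith [abs_nonneg ξ]
  obtain ⟨c, hc⟩ : ∃ c, c = 1 / (4 * K) := ⟨_, rfl⟩
  have hc0 : 0 < c := by rw [hc]; positivity
  have hc1 : c < 1 := by rw [hc, div_lt_one (by linarith)]; linarith
  refine ⟨c / 2, by positivity, ?_⟩
  by_contra! hcon
  obtain ⟨N₀, hN₀⟩ := hcon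
  have hdist : ∀ N : ℕ, N₀ ≤ N → 1 ≤ N →
      ∃ n, 0 < n ∧ n ≤ N ∧ sqDist ξ n ≤ c / 2 * (N : ℝ) ^ (-lam) := by
    intro N hN hN1
    obtain ⟨x₀, x₁, x₂, hne, hle, habs⟩ := hN₀ N hN
    have hN1R : (1 : ℝ) ≤ N := by exact_mod_cast hN1
    have hx₀ : x₀ ≠ 0 := by
      rintro rfl
      have hlt : max |(x₁ : ℝ)| |(x₂ : ℝ)| < 1 := by
        have h : (N : ℝ) ^ (-lam) ≤ 1 :=
          Real.rpow_le_one_of_one_le_of_nonpos hN1R (by linarith)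
        have hle' : max |(x₁ : ℝ)| |(x₂ : ℝ)| ≤ c / 2 * (N : ℝ) ^ (-lam) := by simpa using hle
        nlinarith
      have h0 : ∀ n : ℤ, |(n : ℝ)| < 1 → n = 0 := fun n hn ↦ by
        by_contra h
        exact absurd (one_le_abs_intCast h) (not_le.2 hn)
      rw [h0 x₁ ((le_max_left _ _).trans_lt hlt), h0 x₂ ((le_max_right _ _).trans_lt hlt)] at hne
      exact hne rfl
    refine ⟨x₀.natAbs, Int.natAbs_pos.2 hx₀, ?_, ?_⟩
    · have : ((x₀.natAbs : ℕ) : ℝ) ≤ N := by rwa [Nat.cast_natAbs, Int.cast_abs]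
      exact_mod_cast this
    · refine le_trans ?_ hle
      rcases lt_or_gt_of_ne hx₀ with h | h
      · have e : ((x₀.natAbs : ℕ) : ℝ) = -x₀ := by
          rw [Nat.cast_natAbs, abs_of_neg h, Int.cast_neg]
        refine (sqDist_le ξ _ (-x₁) (-x₂)).trans_eq ?_
        rw [e, ← abs_neg ((x₁ : ℝ) - _), ← abs_neg ((x₂ : ℝ) - _)]
        push_cast
        congr 2 <;> ring
      · have e : ((x₀.natAbs : ℕ) : ℝ) = x₀ := by
          rw [Nat.cast_natAbs, abs_of_pos h]
        refine (sqDist_le ξ _ x₁ x₂).trans_eq ?_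
        rw [e]
  have hpow : Filter.Tendsto (fun x : ℝ ↦ c * x ^ (-lam)) Filter.atTop (nhds 0) := by
    simpa using (tendsto_rpow_neg_atTop (by linarith : 0 < lam)).const_mul c
  have hnomin : ∀ q, 0 < q → ∃ n, 0 < n ∧ sqDist ξ n < sqDist ξ q := by
    intro q hq
    have hqpos : 0 < sqDist ξ q := by
      by_contra! h
      have h1 : |(round (q * ξ) : ℝ) - q * ξ| ≤ 0 := (le_max_left _ _).trans h
      have h2 : ((round (q * ξ) : ℤ) : ℝ) + ((-q : ℤ) : ℝ) * ξ + ((0 : ℤ) : ℝ) * ξ ^ 2 = 0 := by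
        push_cast
        linear_combination abs_nonpos_iff.1 h1
      have := (int_relation_eq_zero hξ h2).1
      omega
    have hev := (hpow.comp tendsto_natCast_atTop_atTop).eventually_lt_const hqpos
    obtain ⟨N, hN, hNN⟩ := (hev.and (Filter.eventually_ge_atTop (max N₀ 1))).exists
    obtain ⟨n, hn, -, hle⟩ := hdist N ((le_max_left _ _).trans hNN) ((le_max_right _ _).trans hNN)
    refine ⟨n, hn, hle.trans_lt (lt_of_le_of_lt ?_ hN)⟩
    have : 0 ≤ (N : ℝ) ^ (-lam) := by positivity
    simp only [Function.comp_apply]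
    nlinarith
  obtain ⟨q, hq, hpos, hdec, hrec⟩ := exists_record_sequence (sqDist ξ) hnomin
  have hbound : ∀ i, N₀ + 1 ≤ i → sqDist ξ (q i) ≤ c * (q (i + 1) : ℝ) ^ (-lam) := by
    intro i hi
    have hqi : i + 1 ≤ q (i + 1) := hq.le_apply
    obtain ⟨n, hn, hnN, hle⟩ := hdist (q (i + 1) - 1) (by omega) (by omega)
    refine ((hrec i n hn (by omega)).trans hle).trans ?_
    have hq2 : (2 : ℝ) ≤ q (i + 1) := by exact_mod_cast (by omega : 2 ≤ q (i + 1))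
    have h1 : ((q (i + 1) - 1 : ℕ) : ℝ) ^ (-lam) ≤ ((q (i + 1) : ℝ) / 2) ^ (-lam) := by
      refine Real.rpow_le_rpow_of_nonpos (by linarith) ?_ (by linarith)
      rw [Nat.cast_sub (by omega)]
      push_cast
      linarith
    have h2 : ((q (i + 1) : ℝ) / 2) ^ (-lam) = 2 ^ lam * (q (i + 1) : ℝ) ^ (-lam) := by
      rw [Real.div_rpow (by linarith) (by norm_num), Real.rpow_neg (by norm_num : (0 : ℝ) ≤ 2)]
      field_simp
    have h3 : (2 : ℝ) ^ lam ≤ 2 := by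
      simpa using Real.rpow_le_rpow_of_exponent_le (by norm_num : (1 : ℝ) ≤ 2) hlam_one
    calc c / 2 * ((q (i + 1) - 1 : ℕ) : ℝ) ^ (-lam)
        ≤ c / 2 * (2 * (q (i + 1) : ℝ) ^ (-lam)) := by
          rw [h2] at h1
          exact mul_le_mul_of_nonneg_left (h1.trans (by gcongr)) (by positivity)
      _ = _ := by ring
  have hlim : Filter.Tendsto (fun i ↦ sqDist ξ (q i)) Filter.atTop (nhds 0) := by
    have h := (hpow.comp tendsto_natCast_atTop_atTop).comp
      (hq.tendsto_atTop.comp (Filter.tendsto_add_atTop_nat 1))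
    refine squeeze_zero' (Filter.Eventually.of_forall fun i ↦
      (abs_nonneg _).trans (le_max_left _ _)) ?_ h
    filter_upwards [Filter.eventually_ge_atTop (N₀ + 1)] with i hi using hbound i hi
  obtain ⟨i, hi, hdet⟩ := exists_tripleDet_ne_zero hξ hq hpos hdec hlim (N₀ + 1)
  have hq1 : ∀ j, (1 : ℤ) ≤ q j := fun j ↦ by exact_mod_cast hpos j
  have hq1R : ∀ j, (1 : ℝ) ≤ q j := fun j ↦ by exact_mod_cast hpos j
  have hle : ∀ j, (q j : ℤ) ≤ q (j + 1) := fun j ↦ by exact_mod_cast hq.monotone (Nat.le_succ j)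
  have hl : ∀ j, |((round (q j * ξ) : ℤ) : ℝ) - ((q j : ℤ) : ℝ) * ξ| ≤ sqDist ξ (q j) := fun j ↦ by
    rw [Int.cast_natCast]; exact le_max_left _ _
  have hr : ∀ j, |((round (q j * ξ ^ 2) : ℤ) : ℝ) - ((q j : ℤ) : ℝ) * ξ ^ 2| ≤ sqDist ξ (q j) :=
    fun j ↦ by rw [Int.cast_natCast]; exact le_max_right _ _
  have h0 : ∀ j, 0 ≤ sqDist ξ (q j) := fun j ↦ (abs_nonneg _).trans (hl j)
  have h1 := one_le_of_tripleDet_ne_zero (hq1 i) (hle i) (hle (i + 1)) (hl i) (hr i) (hl (i + 1))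
    (hr (i + 1)) (hl (i + 2)) (hr (i + 2)) (hdec i).le (hdec (i + 1)).le hdet
  refine not_uniform_exponent hlam_half hlam_sq (hq1R (i + 1)) (hq1R (i + 2)) hK2 hc (h0 i)
    (hbound i hi) (hbound (i + 1) (by omega)) (by simpa using h1) ?_
  by_cases hdisc : (q (i + 1) : ℤ) * round (q (i + 1) * ξ ^ 2) = round (q (i + 1) * ξ) ^ 2
  · right
    have := one_le_of_disc_eq_zero (hq1 i) (hle i) (hl (i + 1)) (hl i) (hr i) (hdec i).le
      (sqDist_le_one ξ _) hdisc
      (not_proportional_of_sqDist_lt (hpos i) (hq (Nat.lt_succ_self i)) (hdec i))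
    simpa [hK] using this
  · left
    have := one_le_of_disc_ne_zero (hq1 (i + 1)) (hl (i + 1)) (hr (i + 1)) (sqDist_le_one ξ _) hdisc
    simpa [hK] using this
end

section
/- Wirsing's theorem: Let n be a positive integer and let ξ be a real number which is not algebraic of degree ≤ n. Then there is a constant c(ξ, n) > 0 such that there exist infinitely many real algebraic numbers α of degree ≤ n with |ξ − α| ≤ c(ξ, n) · H(α)^{−(n+3)/2}. -/
/-- The (usual) height of an integer polynomial: the maximum of the absolute
values of its coefficients. -/
noncomputable def intPolyHeight (f : Polynomial ℤ) : ℕ :=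
  (Finset.range (f.natDegree + 1)).sup fun i => (f.coeff i).natAbs

/-- `P` is the minimal polynomial over `ℤ` of the real algebraic number `α`:
a primitive integer polynomial with positive leading coefficient, vanishing at
`α`, of minimal degree among nonzero integer polynomials vanishing at `α`. -/
def IsMinIntPoly (α : ℝ) (P : Polynomial ℤ) : Prop :=
  P ≠ 0 ∧ 0 < P.leadingCoeff ∧ P.content = 1 ∧ Polynomial.aeval α P = 0 ∧
    ∀ Q : Polynomial ℤ, Q ≠ 0 → Polynomial.aeval α Q = 0 → P.natDegree ≤ Q.natDegree

open Polynomial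

/-- The sum of `min x y` over all pairs `(x, y)` in `s × t`. -/
noncomputable def pairMinSum (s t : Multiset ℝ) : ℝ :=
  (s.map fun x => (t.map fun y => min x y).sum).sum

lemma pairMinSum_comm (s t : Multiset ℝ) : pairMinSum s t = pairMinSum t s := by
  unfold pairMinSum
  rw [Multiset.sum_map_sum_map]
  simp only [min_comm]

lemma two_mul_le_sum_min {x y w : ℝ} {t : Multiset ℝ} (hx : 0 ≤ x) (ht : ∀ z ∈ t, 0 ≤ z)
    (hw : w ∈ t) (hxy : x ≤ y) (hxw : x ≤ w) :
    2 * x ≤ ((y ::ₘ t).map fun z => min x z).sum := by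
  obtain ⟨r, rfl⟩ := Multiset.exists_cons_of_mem hw
  have : 0 ≤ (r.map fun z => min x z).sum := by
    apply Multiset.sum_nonneg
    intro a ha
    obtain ⟨z, hz, rfl⟩ := Multiset.mem_map.1 ha
    exact le_min hx (ht z (Multiset.mem_cons_of_mem hz))
  simp only [Multiset.map_cons, Multiset.sum_cons, min_eq_left hxy, min_eq_left hxw]
  linarith

lemma two_mul_sum_le_pairMinSum {s t : Multiset ℝ} {y w : ℝ} (hs : ∀ x ∈ s, 0 ≤ x)
    (ht : ∀ z ∈ t, 0 ≤ z) (hw : w ∈ t) (hy : ∀ x ∈ s, x ≤ y) (hsw : ∀ x ∈ s, x ≤ w) :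
    2 * s.sum ≤ pairMinSum s (y ::ₘ t) := by
  rw [← Multiset.map_id' s, ← Multiset.sum_map_mul_left, pairMinSum, Multiset.map_id']
  exact Multiset.sum_map_le_sum_map _ _ fun x hx =>
    two_mul_le_sum_min (hs x hx) ht hw (hy x hx) (hsw x hx)

lemma pairMinSum_cons_left (x : ℝ) (s t : Multiset ℝ) :
    pairMinSum (x ::ₘ s) t = (t.map fun y => min x y).sum + pairMinSum s t := by
  simp [pairMinSum]

lemma sum_map_min_eq_sum {x : ℝ} {t : Multiset ℝ} (h : ∀ y ∈ t, y ≤ x) :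
    (t.map fun y => min x y).sum = t.sum := by
  conv_rhs => rw [← Multiset.map_id' t]
  exact congrArg Multiset.sum (Multiset.map_congr rfl fun y hy => min_eq_right (h y hy))

/-- The combinatorial heart of Wirsing's argument: two families of exponents with large sums and
small `pairMinSum` have a dominant largest element. -/
lemma largest_exponent_bound {n : ℕ} {s t : Multiset ℝ} {x y L u v K : ℝ}
    (hs : ∀ z ∈ x ::ₘ s, 0 ≤ z) (ht : ∀ z ∈ y ::ₘ t, 0 ≤ z)
    (hx : ∀ z ∈ s, z ≤ x) (hxy : x ≤ y) (hn : 1 ≤ n)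
    (hcard : t.card + 1 ≤ n) (hu : 0 ≤ u) (huL : u ≤ L) (hvL : v ≤ L)
    (hK : 3 * K < L)
    (hX : u + n * L - K ≤ (x ::ₘ s).sum) (hY : v + n * L - K ≤ (y ::ₘ t).sum)
    (hG : pairMinSum (x ::ₘ s) (y ::ₘ t) ≤ n * (u + v) + K) :
    (∀ z ∈ t, z < x) ∧ (n + 1) * L + 2 * v - 4 * K ≤ 2 * y := by
  have hn' : (1 : ℝ) ≤ n := by exact_mod_cast hn
  have hL : 0 ≤ L := hu.trans huL
  have hnu : L - u ≤ n * (L - u) := by nlinarith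
  have hnv : L - v ≤ n * (L - v) := by nlinarith
  have hs' : ∀ z ∈ s, 0 ≤ z := fun z hz => hs z (Multiset.mem_cons_of_mem hz)
  have ht' : ∀ z ∈ t, 0 ≤ z := fun z hz => ht z (Multiset.mem_cons_of_mem hz)
  have hxx : ∀ z ∈ x ::ₘ s, z ≤ x := by
    intro z hz
    rcases Multiset.mem_cons.1 hz with rfl | h
    exacts [le_rfl, hx z h]
  have first : ∀ z ∈ t, z < x := by
    intro z hz
    by_contra! h
    have := two_mul_sum_le_pairMinSum hs ht' hz (fun a ha => (hxx a ha).trans hxy)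
      (fun a ha => (hxx a ha).trans h)
    nlinarith
  refine ⟨first, ?_⟩
  by_cases hc : ∀ z ∈ t, ∃ w ∈ s, z ≤ w
  · have h1 : (x ::ₘ s).sum + 2 * t.sum ≤ pairMinSum (x ::ₘ s) (y ::ₘ t) := by
      rw [pairMinSum_comm, pairMinSum_cons_left,
        sum_map_min_eq_sum (fun a ha => (hxx a ha).trans hxy)]
      gcongr
      rw [← Multiset.map_id' t, ← Multiset.sum_map_mul_left, pairMinSum, Multiset.map_id']
      refine Multiset.sum_map_le_sum_map _ _ fun z hz => ?_
      obtain ⟨w, hw, hzw⟩ := hc z hz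
      exact two_mul_le_sum_min (ht' z hz) hs' hw (first z hz).le hzw
    rw [Multiset.sum_cons _ t] at hY
    nlinarith
  · push Not at hc
    obtain ⟨w, hw, hsw⟩ := hc
    have hn2 : (2 : ℝ) ≤ n := by
      have : 0 < t.card := Multiset.card_pos_iff_exists_mem.2 ⟨w, hw⟩
      exact_mod_cast (by omega : 2 ≤ n)
    have hnu : 2 * (L - u) ≤ n * (L - u) := by nlinarith
    have h1 : x + t.sum + 2 * s.sum ≤ pairMinSum (x ::ₘ s) (y ::ₘ t) := by
      rw [pairMinSum_cons_left, Multiset.map_cons, Multiset.sum_cons, min_eq_left hxy,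
        sum_map_min_eq_sum (fun z hz => (first z hz).le)]
      gcongr
      exact two_mul_sum_le_pairMinSum hs' ht' hw (fun z hz => (hx z hz).trans hxy)
        (fun z hz => (hsw z hz).le)
    rw [Multiset.sum_cons] at hX hY
    nlinarith

/-- The image of an integer polynomial in `ℂ[X]`. -/
noncomputable abbrev toComplexPoly (P : ℤ[X]) : ℂ[X] := P.map (Int.castRingHom ℂ)

/-- The logarithmic Mahler measure of `P(X + ξ)`, written in terms of the roots of `P`. -/
noncomputable def logHeightAt (ξ : ℝ) (P : ℤ[X]) : ℝ :=
  Real.log ‖(toComplexPoly P).leadingCoeff‖ +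
    ((toComplexPoly P).roots.map fun a => Real.posLog ‖(ξ : ℂ) - a‖).sum

/-- The logarithmic proximity of `a` to `ξ`. -/
noncomputable def proximity (ξ : ℝ) (a : ℂ) : ℝ := Real.posLog ‖(ξ : ℂ) - a‖⁻¹

lemma proximity_nonneg (ξ : ℝ) (a : ℂ) : 0 ≤ proximity ξ a := Real.posLog_nonneg

lemma proximity_conj (ξ : ℝ) (a : ℂ) : proximity ξ (starRingEnd ℂ a) = proximity ξ a := by
  unfold proximity
  rw [← Complex.norm_conj ((ξ : ℂ) - a)]
  simp

lemma log_norm_sub_eq (ξ : ℝ) (a : ℂ) :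
    Real.log ‖(ξ : ℂ) - a‖ = Real.posLog ‖(ξ : ℂ) - a‖ - proximity ξ a :=
  (Real.posLog_sub_posLog_inv).symm

lemma log_norm_sub_le {ξ : ℝ} {a b : ℂ} (hab : a ≠ b) (ha : (ξ : ℂ) ≠ a) (hb : (ξ : ℂ) ≠ b) :
    Real.log ‖a - b‖ ≤ Real.log 2 + Real.posLog ‖(ξ : ℂ) - a‖ + Real.posLog ‖(ξ : ℂ) - b‖
      - min (proximity ξ a) (proximity ξ b) := by
  have h0 : 0 < ‖a - b‖ := norm_pos_iff.2 (sub_ne_zero.2 hab)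
  have hA : 0 < ‖(ξ : ℂ) - a‖ := norm_pos_iff.2 (sub_ne_zero.2 ha)
  have hB : 0 < ‖(ξ : ℂ) - b‖ := norm_pos_iff.2 (sub_ne_zero.2 hb)
  have htri : ‖a - b‖ ≤ ‖(ξ : ℂ) - a‖ + ‖(ξ : ℂ) - b‖ := by
    have := norm_sub_le ((ξ : ℂ) - b) ((ξ : ℂ) - a)
    rw [show (ξ : ℂ) - b - (ξ - a) = a - b by ring] at this
    linarith
  have pa : 0 ≤ Real.posLog ‖(ξ : ℂ) - a‖ := Real.posLog_nonneg
  have pb : 0 ≤ Real.posLog ‖(ξ : ℂ) - b‖ := Real.posLog_nonneg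
  have ea := log_norm_sub_eq ξ a
  have eb := log_norm_sub_eq ξ b
  rcases le_total ‖(ξ : ℂ) - a‖ ‖(ξ : ℂ) - b‖ with h | h
  · have := Real.log_le_log h0 (show ‖a - b‖ ≤ 2 * ‖(ξ : ℂ) - b‖ by linarith)
    rw [Real.log_mul two_ne_zero hB.ne'] at this
    have := min_le_right (proximity ξ a) (proximity ξ b)
    linarith
  · have := Real.log_le_log h0 (show ‖a - b‖ ≤ 2 * ‖(ξ : ℂ) - a‖ by linarith)
    rw [Real.log_mul two_ne_zero hA.ne'] at this
    have := min_le_left (proximity ξ a) (proximity ξ b)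
    linarith

lemma log_norm_eval_eq {f : ℂ[X]} {z : ℂ} (h : f.eval z ≠ 0) :
    Real.log ‖f.eval z‖ =
      Real.log ‖f.leadingCoeff‖ + (f.roots.map fun a => Real.log ‖z - a‖).sum := by
  have hf := (IsAlgClosed.splits f).eval_eq_prod_roots z
  have hne := h
  rw [hf, mul_ne_zero_iff] at hne
  have hprod : ‖(f.roots.map (z - ·)).prod‖ = (f.roots.map fun a => ‖z - a‖).prod := by
    rw [← normHom_apply, map_multiset_prod, Multiset.map_map]
    rfl
  rw [hf, norm_mul, Real.log_mul (norm_ne_zero_iff.2 hne.1) (norm_ne_zero_iff.2 hne.2), hprod,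
    Real.log_multiset_prod, Multiset.map_map]
  · rfl
  · intro x hx
    obtain ⟨a, ha, rfl⟩ := Multiset.mem_map.1 hx
    intro h0
    exact hne.2 (Multiset.prod_eq_zero (Multiset.mem_map.2 ⟨a, ha, norm_eq_zero.1 h0⟩))

lemma toComplexPoly_eval (ξ : ℝ) (P : ℤ[X]) :
    (toComplexPoly P).eval (ξ : ℂ) = ((aeval ξ P : ℝ) : ℂ) := by
  rw [eval_map, aeval_def]
  exact (hom_eval₂ P (algebraMap ℤ ℝ) Complex.ofRealHom ξ).symm

lemma toComplexPoly_ne_zero {P : ℤ[X]} (hP : P ≠ 0) : toComplexPoly P ≠ 0 :=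
  (Polynomial.map_ne_zero_iff (RingHom.injective_int _)).2 hP

lemma sum_proximity_eq {ξ : ℝ} {P : ℤ[X]} (h : aeval ξ P ≠ 0) :
    ((toComplexPoly P).roots.map (proximity ξ)).sum
      = logHeightAt ξ P - Real.log |aeval ξ P| := by
  have h1 : (toComplexPoly P).eval (ξ : ℂ) ≠ 0 := by
    rw [toComplexPoly_eval]
    exact_mod_cast h
  have h2 := log_norm_eval_eq h1
  rw [toComplexPoly_eval, Complex.norm_real, Real.norm_eq_abs] at h2
  rw [h2, logHeightAt]
  simp only [log_norm_sub_eq, Multiset.sum_map_sub]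
  ring

lemma card_roots_toComplexPoly (P : ℤ[X]) :
    Multiset.card (toComplexPoly P).roots = P.natDegree := by
  rw [splits_iff_card_roots.1 (IsAlgClosed.splits (toComplexPoly P)),
    natDegree_map_eq_of_injective (RingHom.injective_int _)]

lemma norm_leadingCoeff_toComplexPoly (P : ℤ[X]) :
    ‖(toComplexPoly P).leadingCoeff‖ = |(P.leadingCoeff : ℝ)| := by
  rw [leadingCoeff_map_of_injective (RingHom.injective_int _)]
  simp

lemma log_abs_intCast_nonneg (k : ℤ) : 0 ≤ Real.log |(k : ℝ)| := by
  rw [← Int.cast_abs, Int.abs_eq_natAbs, Int.cast_natCast]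
  exact Real.log_natCast_nonneg _

lemma logHeightAt_nonneg (ξ : ℝ) (P : ℤ[X]) : 0 ≤ logHeightAt ξ P := by
  unfold logHeightAt
  rw [norm_leadingCoeff_toComplexPoly]
  refine add_nonneg ?_ ?_
  · exact log_abs_intCast_nonneg _
  · apply Multiset.sum_nonneg
    intro x hx
    obtain ⟨a, -, rfl⟩ := Multiset.mem_map.1 hx
    exact Real.posLog_nonneg

lemma logHeightAt_mul (ξ : ℝ) {P Q : ℤ[X]} (hP : P ≠ 0) (hQ : Q ≠ 0) :
    logHeightAt ξ (P * Q) = logHeightAt ξ P + logHeightAt ξ Q := by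
  have hP' := toComplexPoly_ne_zero hP
  have hQ' := toComplexPoly_ne_zero hQ
  unfold logHeightAt
  rw [toComplexPoly, Polynomial.map_mul, roots_mul (mul_ne_zero hP' hQ'), leadingCoeff_mul,
    norm_mul, Real.log_mul (by simpa using hP') (by simpa using hQ'), Multiset.map_add,
    Multiset.sum_add]
  ring

lemma ne_of_mem_roots {ξ : ℝ} {P : ℤ[X]} (h : aeval ξ P ≠ 0) {a : ℂ}
    (ha : a ∈ (toComplexPoly P).roots) : (ξ : ℂ) ≠ a := by
  rintro rfl
  have := (mem_roots'.1 ha).2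
  rw [IsRoot, toComplexPoly_eval] at this
  exact h (by exact_mod_cast this)

/-- The resultant of coprime integer polynomials is at least `1` in absolute value, which bounds
the total proximity of their roots. -/
lemma pairMinSum_proximity_le {ξ : ℝ} {P Q : ℤ[X]} {n : ℕ} (hP : aeval ξ P ≠ 0)
    (hQ : aeval ξ Q ≠ 0) (hPn : P.natDegree ≤ n) (hQn : Q.natDegree ≤ n)
    (hcop : IsCoprime (P.map (Int.castRingHom ℚ)) (Q.map (Int.castRingHom ℚ))) :
    pairMinSum ((toComplexPoly P).roots.map (proximity ξ))
        ((toComplexPoly Q).roots.map (proximity ξ))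
      ≤ n * (logHeightAt ξ P + logHeightAt ξ Q) + n ^ 2 * Real.log 2 := by
  have hP0 : P ≠ 0 := by rintro rfl; simp at hP
  set f := toComplexPoly P with hf
  set g := toComplexPoly Q with hg
  have hres : resultant P Q ≠ 0 := by
    intro h
    have h1 := resultant_map_map P Q P.natDegree Q.natDegree (Int.castRingHom ℚ)
    rw [h, map_zero] at h1
    have h2 : resultant (P.map (Int.castRingHom ℚ)) (Q.map (Int.castRingHom ℚ)) = 0 := by
      rwa [natDegree_map_eq_of_injective (RingHom.injective_int _),
        natDegree_map_eq_of_injective (RingHom.injective_int _)]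
    exact (resultant_eq_zero_iff.1 h2).2 hcop
  have hfd : f.natDegree = P.natDegree := natDegree_map_eq_of_injective (RingHom.injective_int _) _
  have hgd : g.natDegree = Q.natDegree := natDegree_map_eq_of_injective (RingHom.injective_int _) _
  have hresC : resultant f g P.natDegree Q.natDegree = ((resultant P Q : ℤ) : ℂ) :=
    resultant_map_map P Q P.natDegree Q.natDegree (Int.castRingHom ℂ)
  have heval := resultant_eq_prod_eval f g Q.natDegree hgd.le (IsAlgClosed.splits f)
  rw [hfd, hresC] at heval
  have hne : f.leadingCoeff ^ Q.natDegree * (f.roots.map g.eval).prod ≠ 0 := by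
    rw [← heval]
    exact_mod_cast hres
  rw [mul_ne_zero_iff] at hne
  have hgne : ∀ a ∈ f.roots, g.eval a ≠ 0 := fun a ha h0 =>
    hne.2 (Multiset.prod_eq_zero (Multiset.mem_map.2 ⟨a, ha, h0⟩))
  have hlog : 0 ≤ Q.natDegree * Real.log ‖f.leadingCoeff‖ +
      (f.roots.map fun a => Real.log ‖g.eval a‖).sum := by
    have h1 : 0 ≤ Real.log ‖((resultant P Q : ℤ) : ℂ)‖ := by
      rw [Complex.norm_intCast]
      exact log_abs_intCast_nonneg _
    have hprod : ‖(f.roots.map g.eval).prod‖ = (f.roots.map fun a => ‖g.eval a‖).prod := by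
      rw [← normHom_apply, map_multiset_prod, Multiset.map_map]
      rfl
    rw [heval, norm_mul, Real.log_mul (norm_ne_zero_iff.2 hne.1) (norm_ne_zero_iff.2 hne.2),
      norm_pow, Real.log_pow, hprod, Real.log_multiset_prod, Multiset.map_map] at h1
    · exact h1
    · intro x hx
      obtain ⟨a, ha, rfl⟩ := Multiset.mem_map.1 hx
      exact norm_ne_zero_iff.2 (hgne a ha)
  have hpoint : ∀ a ∈ f.roots, Real.log ‖g.eval a‖ ≤ logHeightAt ξ Q + Q.natDegree * Real.log 2
      + Q.natDegree * Real.posLog ‖(ξ : ℂ) - a‖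
      - (g.roots.map fun b => min (proximity ξ a) (proximity ξ b)).sum := by
    intro a ha
    rw [log_norm_eval_eq (hgne a ha)]
    have h1 : (g.roots.map fun b => Real.log ‖a - b‖).sum ≤
        (g.roots.map fun b => Real.log 2 + Real.posLog ‖(ξ : ℂ) - a‖ + Real.posLog ‖(ξ : ℂ) - b‖
          - min (proximity ξ a) (proximity ξ b)).sum := by
      refine Multiset.sum_map_le_sum_map _ _ fun b hb => ?_
      refine log_norm_sub_le ?_ (ne_of_mem_roots hP ha) (ne_of_mem_roots hQ hb)
      rintro rfl
      exact hgne a ha (mem_roots'.1 hb).2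
    rw [Multiset.sum_map_sub, Multiset.sum_map_add, Multiset.map_const', Multiset.sum_replicate,
      card_roots_toComplexPoly, nsmul_eq_mul] at h1
    unfold logHeightAt
    linarith
  have hsum := Multiset.sum_map_le_sum_map _ _ hpoint
  simp only [Multiset.sum_map_sub, Multiset.sum_map_add, Multiset.map_const',
    Multiset.sum_replicate, Multiset.sum_map_mul_left] at hsum
  rw [card_roots_toComplexPoly, nsmul_eq_mul] at hsum
  have hG : pairMinSum (f.roots.map (proximity ξ)) (g.roots.map (proximity ξ)) =
      (f.roots.map fun a =>
        (g.roots.map fun b => min (proximity ξ a) (proximity ξ b)).sum).sum := by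
    simp [pairMinSum, Multiset.map_map]
  have hPdef : logHeightAt ξ P = Real.log ‖f.leadingCoeff‖ +
    (f.roots.map fun a => Real.posLog ‖(ξ : ℂ) - a‖).sum := rfl
  have hu := logHeightAt_nonneg ξ P
  have hv := logHeightAt_nonneg ξ Q
  have hp' : (P.natDegree : ℝ) ≤ n := by exact_mod_cast hPn
  have hq' : (Q.natDegree : ℝ) ≤ n := by exact_mod_cast hQn
  have hl2 : 0 ≤ Real.log 2 := Real.log_nonneg one_le_two
  have e1 : (Q.natDegree : ℝ) * logHeightAt ξ P ≤ n * logHeightAt ξ P := by gcongr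
  have e2 : (P.natDegree : ℝ) * logHeightAt ξ Q ≤ n * logHeightAt ξ Q := by gcongr
  have e3 : (P.natDegree : ℝ) * (Q.natDegree * Real.log 2) ≤ n * (n * Real.log 2) := by gcongr
  rw [hG]
  rw [hPdef] at e1 ⊢
  linarith

lemma conj_mem_roots_toComplexPoly {P : ℤ[X]} {a : ℂ} (ha : a ∈ (toComplexPoly P).roots) :
    starRingEnd ℂ a ∈ (toComplexPoly P).roots := by
  rw [mem_roots'] at ha ⊢
  refine ⟨ha.1, ?_⟩
  have h := ha.2
  rw [IsRoot, eval_map] at h ⊢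
  have h2 := hom_eval₂ P (Int.castRingHom ℂ) (starRingEnd ℂ) a
  rw [h, map_zero] at h2
  rw [h2]
  congr 1
  exact RingHom.ext_int _ _

lemma exists_roots_eq_cons {ξ : ℝ} {P : ℤ[X]}
    (h : 0 < ((toComplexPoly P).roots.map (proximity ξ)).sum) :
    ∃ a s, (toComplexPoly P).roots = a ::ₘ s ∧ ∀ b ∈ s, proximity ξ b ≤ proximity ξ a := by
  classical
  have hne : (toComplexPoly P).roots.toFinset.Nonempty := by
    rw [Multiset.toFinset_nonempty]
    intro h0
    simp [h0] at h
  obtain ⟨a, ha, hmax⟩ := Finset.exists_max_image _ (proximity ξ) hne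
  obtain ⟨s, hs⟩ := Multiset.exists_cons_of_mem (Multiset.mem_toFinset.1 ha)
  refine ⟨a, s, hs, fun b hb => hmax b ?_⟩
  rw [Multiset.mem_toFinset, hs]
  exact Multiset.mem_cons_of_mem hb

lemma exists_real_root_of_proximity_le {ξ : ℝ} {P Q : ℤ[X]} {n : ℕ} {L K : ℝ} {a b : ℂ}
    {s t : Multiset ℂ} (hP : aeval ξ P ≠ 0) (hQ : aeval ξ Q ≠ 0)
    (hPn : P.natDegree ≤ n) (hQn : Q.natDegree ≤ n)
    (hcop : IsCoprime (P.map (Int.castRingHom ℚ)) (Q.map (Int.castRingHom ℚ)))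
    (hPL : logHeightAt ξ P ≤ L) (hQL : logHeightAt ξ Q ≤ L)
    (hPξ : Real.log |aeval ξ P| ≤ K - n * L) (hQξ : Real.log |aeval ξ Q| ≤ K - n * L)
    (hK : n ^ 2 * Real.log 2 ≤ K) (hKL : 3 * K < L)
    (has : (toComplexPoly P).roots = a ::ₘ s) (hbt : (toComplexPoly Q).roots = b ::ₘ t)
    (hs : ∀ z ∈ s, proximity ξ z ≤ proximity ξ a) (hab : proximity ξ a ≤ proximity ξ b) :
    ∃ β : ℝ, aeval β Q = 0 ∧
      (n + 1) * L + 2 * logHeightAt ξ Q - 4 * K ≤ 2 * proximity ξ β := by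
  have hnonneg : ∀ r : Multiset ℂ, ∀ z ∈ r.map (proximity ξ), 0 ≤ z := by
    intro r z hz
    obtain ⟨c, -, rfl⟩ := Multiset.mem_map.1 hz
    exact proximity_nonneg ξ c
  have hcard : t.card + 1 ≤ n := by
    rw [← Multiset.card_cons b t, ← hbt, card_roots_toComplexPoly]
    exact hQn
  have hX := sum_proximity_eq hP
  have hY := sum_proximity_eq hQ
  have hG := pairMinSum_proximity_le hP hQ hPn hQn hcop
  rw [has, Multiset.map_cons] at hX
  rw [hbt, Multiset.map_cons] at hY
  rw [has, hbt, Multiset.map_cons, Multiset.map_cons] at hG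
  obtain ⟨h1, h2⟩ := largest_exponent_bound (n := n) (s := s.map (proximity ξ))
    (t := t.map (proximity ξ)) (x := proximity ξ a) (y := proximity ξ b) (L := L)
    (u := logHeightAt ξ P) (v := logHeightAt ξ Q) (K := K)
    (by simpa using hnonneg (a ::ₘ s)) (by simpa using hnonneg (b ::ₘ t))
    (by simpa using hs) hab (by omega) (by simpa using hcard) (logHeightAt_nonneg ξ P)
    hPL hQL hKL (by linarith) (by linarith) (by linarith)
  have hbmem : b ∈ (toComplexPoly Q).roots := by simp [hbt]
  have hreal : starRingEnd ℂ b = b := by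
    by_contra hne
    have hm := conj_mem_roots_toComplexPoly hbmem
    rw [hbt, Multiset.mem_cons, or_iff_right hne] at hm
    have := h1 _ (Multiset.mem_map_of_mem _ hm)
    rw [proximity_conj] at this
    exact absurd hab this.not_ge
  have hre : ((b.re : ℝ) : ℂ) = b := Complex.conj_eq_iff_re.1 hreal
  refine ⟨b.re, ?_, by rwa [hre]⟩
  have := (mem_roots'.1 hbmem).2
  rw [IsRoot, ← hre, toComplexPoly_eval] at this
  exact_mod_cast this

/-- Of two coprime integer polynomials that are small at `ξ`, one has a real root near `ξ`. -/
lemma exists_real_root_near {ξ : ℝ} {P Q : ℤ[X]} {n : ℕ} {L K : ℝ} (hn : 0 < n)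
    (hP : aeval ξ P ≠ 0) (hQ : aeval ξ Q ≠ 0)
    (hPn : P.natDegree ≤ n) (hQn : Q.natDegree ≤ n)
    (hcop : IsCoprime (P.map (Int.castRingHom ℚ)) (Q.map (Int.castRingHom ℚ)))
    (hPL : logHeightAt ξ P ≤ L) (hQL : logHeightAt ξ Q ≤ L)
    (hPξ : Real.log |aeval ξ P| ≤ K - n * L) (hQξ : Real.log |aeval ξ Q| ≤ K - n * L)
    (hK : n ^ 2 * Real.log 2 ≤ K) (hKL : 3 * K < L) :
    ∃ R : ℤ[X], R ≠ 0 ∧ R.natDegree ≤ n ∧ logHeightAt ξ R ≤ L ∧ ∃ β : ℝ, aeval β R = 0 ∧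
      (n + 1) * L + 2 * logHeightAt ξ R - 4 * K ≤ 2 * proximity ξ β := by
  have hn' : (1 : ℝ) ≤ n := by exact_mod_cast hn
  have hK0 : 0 ≤ K := le_trans (by positivity) hK
  have hnL : L ≤ n * L := le_mul_of_one_le_left (by linarith) hn'
  have hX := sum_proximity_eq hP
  have hY := sum_proximity_eq hQ
  have hu := logHeightAt_nonneg ξ P
  have hv := logHeightAt_nonneg ξ Q
  obtain ⟨a, s, has, hs⟩ := exists_roots_eq_cons (ξ := ξ) (P := P) (by linarith)
  obtain ⟨b, t, hbt, ht⟩ := exists_roots_eq_cons (ξ := ξ) (P := Q) (by linarith)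
  rcases le_total (proximity ξ a) (proximity ξ b) with h | h
  · refine ⟨Q, by rintro rfl; simp at hQ, hQn, hQL, ?_⟩
    exact exists_real_root_of_proximity_le hP hQ hPn hQn hcop hPL hQL hPξ hQξ hK hKL has hbt hs h
  · refine ⟨P, by rintro rfl; simp at hP, hPn, hPL, ?_⟩
    exact exists_real_root_of_proximity_le hQ hP hQn hPn hcop.symm hQL hPL hQξ hPξ hK hKL hbt has
      ht h

lemma posLog_norm_sub_le {E : Type*} [SeminormedAddCommGroup E] (a b : E) :
    Real.posLog ‖a - b‖ ≤ Real.log 2 + Real.posLog ‖a‖ + Real.posLog ‖b‖ := by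
  have := Real.posLog_norm_add_le a (-b)
  rw [norm_neg, ← sub_eq_add_neg] at this
  linarith

lemma logHeightAt_le (ξ : ℝ) {P : ℤ[X]} {n : ℕ} (hn : P.natDegree ≤ n) :
    logHeightAt ξ P ≤
      (toComplexPoly P).logMahlerMeasure + n * (Real.log 2 + Real.posLog |ξ|) := by
  have hc : 0 ≤ Real.log 2 + Real.posLog |ξ| :=
    add_nonneg (Real.log_nonneg one_le_two) Real.posLog_nonneg
  have hn' : (P.natDegree : ℝ) * (Real.log 2 + Real.posLog |ξ|) ≤
      n * (Real.log 2 + Real.posLog |ξ|) := by gcongr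
  have h := Multiset.sum_map_le_sum_map (s := (toComplexPoly P).roots)
    (fun a => Real.posLog ‖(ξ : ℂ) - a‖)
    (fun a => (Real.log 2 + Real.posLog |ξ|) + Real.posLog ‖a‖) fun a _ => by
      have := posLog_norm_sub_le (ξ : ℂ) a
      rwa [Complex.norm_real, Real.norm_eq_abs] at this
  rw [Multiset.sum_map_add, Multiset.map_const', Multiset.sum_replicate,
    card_roots_toComplexPoly, nsmul_eq_mul] at h
  rw [logMahlerMeasure_eq_log_leadingCoeff_add_sum_log_roots, logHeightAt]
  linarith

lemma logMahlerMeasure_le (ξ : ℝ) {P : ℤ[X]} {n : ℕ} (hn : P.natDegree ≤ n) :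
    (toComplexPoly P).logMahlerMeasure ≤
      logHeightAt ξ P + n * (Real.log 2 + Real.posLog |ξ|) := by
  have hc : 0 ≤ Real.log 2 + Real.posLog |ξ| :=
    add_nonneg (Real.log_nonneg one_le_two) Real.posLog_nonneg
  have hn' : (P.natDegree : ℝ) * (Real.log 2 + Real.posLog |ξ|) ≤
      n * (Real.log 2 + Real.posLog |ξ|) := by gcongr
  have h := Multiset.sum_map_le_sum_map (s := (toComplexPoly P).roots)
    (fun a => Real.posLog ‖a‖)
    (fun a => (Real.log 2 + Real.posLog |ξ|) + Real.posLog ‖(ξ : ℂ) - a‖) fun a _ => by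
      have := posLog_norm_sub_le (ξ : ℂ) (ξ - a)
      rwa [Complex.norm_real, Real.norm_eq_abs, sub_sub_cancel] at this
  rw [Multiset.sum_map_add, Multiset.map_const', Multiset.sum_replicate,
    card_roots_toComplexPoly, nsmul_eq_mul] at h
  rw [logMahlerMeasure_eq_log_leadingCoeff_add_sum_log_roots, logHeightAt]
  linarith

lemma mahlerMeasure_le_exp_logMahlerMeasure (f : ℂ[X]) :
    f.mahlerMeasure ≤ Real.exp f.logMahlerMeasure := by
  rcases eq_or_ne f 0 with rfl | hf
  · simp
  · rw [logMahlerMeasure_eq_log_MahlerMeasure, Real.exp_log (mahlerMeasure_pos_of_ne_zero hf)]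

lemma mahlerMeasure_le_exp_logHeightAt (ξ : ℝ) {P : ℤ[X]} {n : ℕ} (hn : P.natDegree ≤ n) :
    (toComplexPoly P).mahlerMeasure ≤
      Real.exp (logHeightAt ξ P + n * (Real.log 2 + Real.posLog |ξ|)) :=
  (mahlerMeasure_le_exp_logMahlerMeasure _).trans (Real.exp_le_exp.2 (logMahlerMeasure_le ξ hn))

/-- Northcott's theorem for `logHeightAt`. -/
lemma finite_logHeightAt_le (ξ : ℝ) (n : ℕ) (B : ℝ) :
    {P : ℤ[X] | P.natDegree ≤ n ∧ logHeightAt ξ P ≤ B}.Finite := by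
  refine (finite_mahlerMeasure_le n
    (Real.toNNReal (Real.exp (B + n * (Real.log 2 + Real.posLog |ξ|))))).subset ?_
  rintro P ⟨hn, hB⟩
  refine ⟨hn, ?_⟩
  rw [Real.coe_toNNReal _ (Real.exp_pos _).le]
  refine (mahlerMeasure_le_exp_logHeightAt ξ hn).trans ?_
  gcongr

lemma logHeightAt_le_of_coeff_le (ξ : ℝ) {P : ℤ[X]} {n : ℕ} {N : ℝ} (hP : P ≠ 0)
    (hn : P.natDegree ≤ n) (hN : 0 < N) (hcoeff : ∀ i, |(P.coeff i : ℝ)| ≤ N) :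
    logHeightAt ξ P ≤
      Real.log N + (Real.log (n + 1) + n * (Real.log 2 + Real.posLog |ξ|)) := by
  have h1 := logHeightAt_le ξ hn
  have h2 : (toComplexPoly P).mahlerMeasure ≤ (n + 1) * N := by
    refine (mahlerMeasure_le_sum_norm_coeff _).trans ?_
    rw [sum_over_range' _ (by simp) (n + 1)
      (Nat.lt_succ_of_le ((natDegree_map_le).trans hn))]
    refine (Finset.sum_le_card_nsmul _ _ N fun i _ => ?_).trans (by simp)
    simpa using hcoeff i
  have h3 := Real.log_le_log (mahlerMeasure_pos_of_ne_zero (toComplexPoly_ne_zero hP)) h2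
  rw [← logMahlerMeasure_eq_log_MahlerMeasure, Real.log_mul (by positivity) hN.ne'] at h3
  linarith

lemma intPolyHeight_le (ξ : ℝ) {P : ℤ[X]} {n : ℕ} (hn : P.natDegree ≤ n) :
    (intPolyHeight P : ℝ) ≤
      2 ^ n * Real.exp (logHeightAt ξ P + n * (Real.log 2 + Real.posLog |ξ|)) := by
  have hi : ∀ i, ((P.coeff i).natAbs : ℝ) ≤
      2 ^ n * Real.exp (logHeightAt ξ P + n * (Real.log 2 + Real.posLog |ξ|)) := by
    intro i
    have h1 := norm_coeff_le_choose_mul_mahlerMeasure i (toComplexPoly P)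
    rw [coeff_map, eq_intCast, Complex.norm_intCast] at h1
    rw [Nat.cast_natAbs, Int.cast_abs]
    refine h1.trans (mul_le_mul ?_ (mahlerMeasure_le_exp_logHeightAt ξ hn)
      (mahlerMeasure_nonneg _) (by positivity))
    have h2 : (toComplexPoly P).natDegree.choose i ≤ 2 ^ n :=
      (Nat.choose_le_two_pow _ _).trans (Nat.pow_le_pow_right two_pos (natDegree_map_le.trans hn))
    exact_mod_cast h2
  obtain ⟨i, -, h⟩ := Finset.exists_mem_eq_sup (Finset.range (P.natDegree + 1)) (by simp)
    fun i => (P.coeff i).natAbs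
  rw [intPolyHeight, h]
  exact hi i

/-- Dirichlet's theorem on small values of integer polynomials at a real point. -/
lemma exists_small_polynomial (ξ : ℝ) {n : ℕ} (hn : 0 < n) :
    ∃ C : ℝ, 0 < C ∧ ∀ N : ℕ, 0 < N → ∃ P : ℤ[X], P ≠ 0 ∧ P.natDegree ≤ n ∧
      (∀ i, |(P.coeff i : ℝ)| ≤ N) ∧ |aeval ξ P| ≤ C / (N : ℝ) ^ n := by
  set A : ℝ := ∑ i : Fin (n + 1), |ξ| ^ (i : ℕ) with hA
  have hApos : 0 < A := by
    refine Finset.sum_pos' (fun i _ => by positivity) ⟨0, Finset.mem_univ _, by simp⟩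
  refine ⟨2 * A, by positivity, fun N hN => ?_⟩
  have hN' : (0 : ℝ) < N := by exact_mod_cast hN
  let V : (Fin (n + 1) → Fin (N + 1)) → ℝ := fun a => ∑ i, ((a i : ℕ) : ℝ) * ξ ^ (i : ℕ)
  have hV : ∀ a, |V a| ≤ A * N := by
    intro a
    rw [hA, Finset.sum_mul]
    refine (Finset.abs_sum_le_sum_abs _ _).trans (Finset.sum_le_sum fun i _ => ?_)
    rw [abs_mul, abs_pow, mul_comm, Nat.abs_cast]
    gcongr
    exact_mod_cast Nat.lt_succ_iff.1 (a i).2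
  let F : (Fin (n + 1) → Fin (N + 1)) → ℕ := fun a => ⌊(V a + A * N) * (N ^ n / (2 * A))⌋₊
  have hnn : ∀ a, 0 ≤ (V a + A * N) * (N ^ n / (2 * A)) := fun a => by
    have := (abs_le.1 (hV a)).1
    have : 0 ≤ V a + A * N := by linarith
    positivity
  have hF : ∀ a ∈ Finset.univ, F a ∈ Finset.range (N ^ (n + 1) + 1) := by
    intro a _
    rw [Finset.mem_range, Nat.lt_succ_iff]
    apply Nat.floor_le_of_le
    have h1 : V a + A * N ≤ 2 * A * N := by linarith [(abs_le.1 (hV a)).2]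
    calc (V a + A * N) * ((N : ℝ) ^ n / (2 * A)) ≤ 2 * A * N * (N ^ n / (2 * A)) := by gcongr
      _ = ((N ^ (n + 1) : ℕ) : ℝ) := by push_cast; field_simp; ring
  have hcard : (Finset.range (N ^ (n + 1) + 1)).card <
      (Finset.univ : Finset (Fin (n + 1) → Fin (N + 1))).card := by
    simp only [Finset.card_range, Finset.card_univ, Fintype.card_pi, Fintype.card_fin,
      Finset.prod_const]
    have h1 : N ^ n ≤ (N + 1) ^ n := Nat.pow_le_pow_left (Nat.le_succ N) n
    have h2 : N + 1 ≤ (N + 1) ^ n := Nat.le_self_pow hn.ne' _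
    rw [pow_succ, pow_succ]
    nlinarith
  obtain ⟨a, -, b, -, hab, hFab⟩ := Finset.exists_ne_map_eq_of_card_lt_of_maps_to hcard hF
  let v : Fin (n + 1) → ℤ := fun i => (a i : ℕ) - (b i : ℕ)
  have hcoeff : ∀ i : Fin (n + 1), (ofFn (n + 1) v).coeff i = v i := fun i => by
    rw [ofFn_coeff_eq_val_of_lt v i.2]
  have hdeg : (ofFn (n + 1) v).natDegree < n + 1 := ofFn_natDegree_lt (by omega) v
  refine ⟨ofFn (n + 1) v, ?_, by omega, ?_, ?_⟩
  · intro h0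
    apply hab
    ext i
    have := hcoeff i
    rw [h0, coeff_zero] at this
    simp only [v] at this
    omega
  · intro i
    by_cases hi : i < n + 1
    · have h1 := hcoeff ⟨i, hi⟩
      rw [h1]
      have ha := (a ⟨i, hi⟩).2
      have hb := (b ⟨i, hi⟩).2
      have : |v ⟨i, hi⟩| ≤ N := by
        simp only [v]
        rw [abs_le]
        omega
      exact_mod_cast this
    · rw [ofFn_coeff_eq_zero_of_ge v (by omega)]
      simp
  · have hval : aeval ξ (ofFn (n + 1) v) = V a - V b := by
      rw [aeval_eq_sum_range' hdeg, ← Fin.sum_univ_eq_sum_range (fun i =>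
        (ofFn (n + 1) v).coeff i • ξ ^ i), ← Finset.sum_sub_distrib]
      refine Finset.sum_congr rfl fun i _ => ?_
      rw [hcoeff, zsmul_eq_mul]
      simp only [v]
      push_cast
      ring
    rw [hval]
    have h1 := Nat.floor_le (hnn a)
    have h2 := Nat.lt_floor_add_one ((V a + A * N) * ((N : ℝ) ^ n / (2 * A)))
    have h3 := Nat.floor_le (hnn b)
    have h4 := Nat.lt_floor_add_one ((V b + A * N) * ((N : ℝ) ^ n / (2 * A)))
    change (F a : ℝ) ≤ _ at h1
    change _ < (F a : ℝ) + 1 at h2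
    rw [hFab] at h1 h2
    change (F b : ℝ) ≤ _ at h3
    change _ < (F b : ℝ) + 1 at h4
    have h5 : |(V a - V b) * ((N : ℝ) ^ n / (2 * A))| ≤ 1 := by
      rw [abs_le]
      constructor <;> linarith
    rw [abs_mul, abs_of_pos (show 0 < (N : ℝ) ^ n / (2 * A) by positivity)] at h5
    rw [le_div_iff₀ (by positivity)]
    rw [← mul_div_assoc, div_le_iff₀ (by positivity)] at h5
    linarith

/-- The logarithm of the quantity `|P(ξ)| H(P) ^ n`, with the height normalised so that it is
additive on products. -/
noncomputable def logDefect (ξ : ℝ) (n : ℕ) (P : ℤ[X]) : ℝ :=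
  Real.log |aeval ξ P| + n * logHeightAt ξ P

lemma logDefect_mul {ξ : ℝ} (n : ℕ) {P Q : ℤ[X]} (hP : aeval ξ P ≠ 0) (hQ : aeval ξ Q ≠ 0) :
    logDefect ξ n (P * Q) = logDefect ξ n P + logDefect ξ n Q := by
  have hP0 : P ≠ 0 := by rintro rfl; simp at hP
  have hQ0 : Q ≠ 0 := by rintro rfl; simp at hQ
  rw [logDefect, logDefect, logDefect, map_mul, abs_mul,
    Real.log_mul (abs_ne_zero.2 hP) (abs_ne_zero.2 hQ), logHeightAt_mul ξ hP0 hQ0]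
  ring

lemma exists_log_aeval_le {ξ : ℝ} {n : ℕ} (hn : 0 < n)
    (hξ : ∀ P : ℤ[X], P ≠ 0 → P.natDegree ≤ n → aeval ξ P ≠ 0) :
    ∃ C K : ℝ, ∀ N : ℕ, 0 < N → ∃ P : ℤ[X], P ≠ 0 ∧ P.natDegree ≤ n ∧
      logHeightAt ξ P ≤ Real.log N + K ∧ Real.log |aeval ξ P| ≤ C - n * Real.log N := by
  obtain ⟨C, hC, h⟩ := exists_small_polynomial ξ hn
  refine ⟨Real.log C, Real.log (n + 1) + n * (Real.log 2 + Real.posLog |ξ|), fun N hN => ?_⟩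
  obtain ⟨P, hP, hPn, hcoeff, hPξ⟩ := h N hN
  have hN' : (0 : ℝ) < N := by exact_mod_cast hN
  refine ⟨P, hP, hPn, logHeightAt_le_of_coeff_le ξ hP hPn hN' hcoeff, ?_⟩
  have := Real.log_le_log (abs_pos.2 (hξ P hP hPn)) hPξ
  rwa [Real.log_div hC.ne' (by positivity), Real.log_pow] at this

lemma exists_infinite_isPrimitive {ξ : ℝ} {n : ℕ} (hn : 0 < n)
    (hξ : ∀ P : ℤ[X], P ≠ 0 → P.natDegree ≤ n → aeval ξ P ≠ 0) :
    ∃ C : ℝ, {P : ℤ[X] | P.IsPrimitive ∧ P.natDegree ≤ n ∧ logDefect ξ n P ≤ C}.Infinite := by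
  obtain ⟨C, K, h⟩ := exists_log_aeval_le hn hξ
  refine ⟨C + n * K, fun hfin => ?_⟩
  obtain ⟨m, hm⟩ := (hfin.image fun P => Real.log |aeval ξ P|).bddBelow
  obtain ⟨N, hN, hN'⟩ : ∃ N : ℕ, 0 < N ∧ C - m < Real.log N := by
    obtain ⟨N, hN⟩ := exists_nat_gt (Real.exp (C - m))
    have hN0 : (0 : ℝ) < N := (Real.exp_pos _).trans hN
    exact ⟨N, by exact_mod_cast hN0, (Real.lt_log_iff_exp_lt hN0).2 hN⟩
  obtain ⟨P, hP, hPn, hPH, hPξ⟩ := h N hN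
  have hc : P.content ≠ 0 := content_eq_zero_iff.not.2 hP
  have hfac := P.eq_C_content_mul_primPart
  have hR : aeval ξ P.primPart ≠ 0 :=
    hξ _ P.primPart_ne_zero (by rwa [natDegree_primPart])
  have hRξ : Real.log |aeval ξ P.primPart| ≤ Real.log |aeval ξ P| := by
    conv_rhs => rw [hfac]
    rw [map_mul, abs_mul, Real.log_mul (by simpa using hc) (abs_ne_zero.2 hR), aeval_C]
    have := log_abs_intCast_nonneg P.content
    simpa using this
  have hRH : logHeightAt ξ P.primPart ≤ logHeightAt ξ P := by
    conv_rhs => rw [hfac]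
    rw [logHeightAt_mul ξ (C_ne_zero.2 hc) P.primPart_ne_zero]
    linarith [logHeightAt_nonneg ξ (Polynomial.C P.content)]
  have hmem : P.primPart ∈
      {P : ℤ[X] | P.IsPrimitive ∧ P.natDegree ≤ n ∧ logDefect ξ n P ≤ C + n * K} := by
    refine ⟨P.isPrimitive_primPart, by rwa [natDegree_primPart], ?_⟩
    have : (n : ℝ) * logHeightAt ξ P.primPart ≤ n * (Real.log N + K) := by
      gcongr
      exact hRH.trans hPH
    rw [logDefect]
    linarith
  have h1 := hm (Set.mem_image_of_mem _ hmem)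
  have h2 : (1 : ℝ) ≤ n := by exact_mod_cast hn
  have h3 : 0 ≤ Real.log N := Real.log_natCast_nonneg N
  nlinarith

lemma natDegree_pos_of_isPrimitive_of_not_isUnit {P : ℤ[X]} (hP : P.IsPrimitive)
    (hu : ¬IsUnit P) : 0 < P.natDegree := by
  by_contra! h0
  rw [eq_C_of_natDegree_le_zero h0] at hu
  exact hu (isUnit_C.2 (hP _ (eq_C_of_natDegree_le_zero h0).symm.dvd))

lemma exists_infinite_irreducible {ξ : ℝ} {n : ℕ} (hn : 0 < n)
    (hξ : ∀ P : ℤ[X], P ≠ 0 → P.natDegree ≤ n → aeval ξ P ≠ 0) :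
    ∃ C : ℝ, {P : ℤ[X] | P.IsPrimitive ∧ Irreducible P ∧ P.natDegree ≤ n ∧
      logDefect ξ n P ≤ C}.Infinite := by
  classical
  let U : ℕ → ℝ → Set ℤ[X] := fun d C =>
    {P | P.IsPrimitive ∧ P.natDegree ≤ d ∧ logDefect ξ n P ≤ C}
  have hex : ∃ d, ∃ C, (U d C).Infinite := ⟨n, exists_infinite_isPrimitive hn hξ⟩
  set d := Nat.find hex
  have hdn : d ≤ n := Nat.find_min' hex (exists_infinite_isPrimitive hn hξ)
  obtain ⟨C, hC⟩ : ∃ C, (U d C).Infinite := Nat.find_spec hex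
  have hfin : ∀ m < d, ∀ C, (U m C).Finite := fun m hm C =>
    Set.not_infinite.1 fun h => Nat.find_min hex hm ⟨C, h⟩
  have hunits : {P : ℤ[X] | IsUnit P}.Finite := by
    refine (Set.toFinite {(1 : ℤ[X]), -1}).subset ?_
    rintro P hP
    obtain ⟨r, hr, rfl⟩ := Polynomial.isUnit_iff.1 hP
    rcases Int.isUnit_iff.1 hr with rfl | rfl <;> simp
  obtain ⟨m, hm⟩ : ∃ m, ∀ P, P.IsPrimitive → P.natDegree < d → logDefect ξ n P ≤ C / 2 →
      m ≤ logDefect ξ n P := by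
    rcases Nat.eq_zero_or_pos d with h0 | h0
    · exact ⟨0, fun P _ h => by omega⟩
    · obtain ⟨m, hm⟩ := ((hfin (d - 1) (by omega) (C / 2)).image (logDefect ξ n)).bddBelow
      exact ⟨m, fun P hP hPd hPC => hm ⟨P, ⟨hP, by omega, hPC⟩, rfl⟩⟩
  have hred : (U d C \ {P | Irreducible P}).Finite := by
    rcases Nat.eq_zero_or_pos d with h0 | h0
    · refine hunits.subset ?_
      rintro P ⟨⟨hP, hPd, -⟩, -⟩
      by_contra hu
      have := natDegree_pos_of_isPrimitive_of_not_isUnit hP hu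
      omega
    refine (hunits.union ((hfin (d - 1) (by omega) (C / 2)).image2 (· * ·)
      (hfin (d - 1) (by omega) (C - m)))).subset ?_
    rintro P ⟨⟨hP, hPd, hPC⟩, hirr⟩
    by_cases hu : IsUnit P
    · exact Or.inl hu
    right
    have hirr' : ¬Irreducible P := hirr
    rw [irreducible_iff] at hirr'
    push Not at hirr'
    obtain ⟨A, B, rfl, hA, hB⟩ := hirr' hu
    have hAp := isPrimitive_of_dvd hP (dvd_mul_right A B)
    have hBp := isPrimitive_of_dvd hP (dvd_mul_left B A)
    have hA0 := natDegree_pos_of_isPrimitive_of_not_isUnit hAp hA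
    have hB0 := natDegree_pos_of_isPrimitive_of_not_isUnit hBp hB
    rw [natDegree_mul hAp.ne_zero hBp.ne_zero] at hPd
    rw [logDefect_mul n (hξ A hAp.ne_zero (by omega)) (hξ B hBp.ne_zero (by omega))] at hPC
    rcases le_total (logDefect ξ n A) (C / 2) with h | h
    · have := hm A hAp (by omega) h
      exact ⟨A, ⟨hAp, by omega, h⟩, B, ⟨hBp, by omega, by linarith⟩, rfl⟩
    · have h' : logDefect ξ n B ≤ C / 2 := by linarith
      have := hm B hBp (by omega) h'
      exact ⟨B, ⟨hBp, by omega, h'⟩, A, ⟨hAp, by omega, by linarith⟩, mul_comm B A⟩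
  refine ⟨C, fun h => hC ((h.union hred).subset fun P hP => ?_)⟩
  by_cases hirr : Irreducible P
  · exact Or.inl ⟨hP.1, hirr, hP.2.1.trans hdn, hP.2.2⟩
  · exact Or.inr ⟨hP, hirr⟩

lemma exists_real_root_proximity_ge {ξ : ℝ} {n : ℕ} (hn : 0 < n)
    (hξ : ∀ P : ℤ[X], P ≠ 0 → P.natDegree ≤ n → aeval ξ P ≠ 0) :
    ∃ K : ℝ, ∀ B : ℝ, ∃ L : ℝ, B ≤ L ∧ ∃ R : ℤ[X], R ≠ 0 ∧ R.natDegree ≤ n ∧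
      logHeightAt ξ R ≤ L ∧ ∃ β : ℝ, aeval β R = 0 ∧
        (n + 1) * L + 2 * logHeightAt ξ R - 4 * K ≤ 2 * proximity ξ β := by
  obtain ⟨C₁, hinf⟩ := exists_infinite_irreducible hn hξ
  obtain ⟨C₂, K₂, h⟩ := exists_log_aeval_le hn hξ
  set K := max (max C₁ (C₂ + n * (K₂ + Real.log 4))) (n ^ 2 * Real.log 2)
  have hK1 : C₁ ≤ K := (le_max_left _ _).trans (le_max_left _ _)
  have hK2 : C₂ + n * (K₂ + Real.log 4) ≤ K := (le_max_right _ _).trans (le_max_left _ _)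
  have hK3 : n ^ 2 * Real.log 2 ≤ K := le_max_right _ _
  refine ⟨K, fun B => ?_⟩
  obtain ⟨P, ⟨hP, hirr, hPn, hPC⟩, hPB⟩ := (hinf.sdiff (finite_logHeightAt_le ξ n
    (max B (max (3 * K) (K₂ + Real.log 2))))).nonempty
  have hL : max B (max (3 * K) (K₂ + Real.log 2)) < logHeightAt ξ P :=
    not_le.1 fun h => hPB ⟨hPn, h⟩
  set L := logHeightAt ξ P
  obtain ⟨hLB, hLK, hL2⟩ : B < L ∧ 3 * K < L ∧ K₂ + Real.log 2 < L := by
    simpa only [max_lt_iff] using hL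
  set x := Real.exp (L - K₂) / 2 with hx
  have hx1 : 1 ≤ x := by
    have : Real.exp (Real.log 2) ≤ Real.exp (L - K₂) := Real.exp_le_exp.2 (by linarith)
    rw [Real.exp_log two_pos] at this
    linarith
  have hlogx : Real.log x = L - K₂ - Real.log 2 := by
    rw [hx, Real.log_div (Real.exp_ne_zero _) two_ne_zero, Real.log_exp]
  have hN : 0 < ⌊x⌋₊ := Nat.floor_pos.2 hx1
  have hN' : (0 : ℝ) < ⌊x⌋₊ := by exact_mod_cast hN
  obtain ⟨Q, hQ, hQn, hQH, hQξ⟩ := h _ hN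
  have hNle : Real.log ⌊x⌋₊ ≤ L - K₂ - Real.log 2 :=
    hlogx ▸ Real.log_le_log hN' (Nat.floor_le (by linarith))
  have hNge : L - K₂ - Real.log 4 ≤ Real.log ⌊x⌋₊ := by
    have h1 : x ≤ 2 * ⌊x⌋₊ := by
      have h2 := Nat.lt_floor_add_one x
      have h3 : (1 : ℝ) ≤ ⌊x⌋₊ := by exact_mod_cast hN
      linarith
    have h4 := Real.log_le_log (by linarith) h1
    rw [Real.log_mul two_ne_zero hN'.ne', hlogx] at h4
    have h5 : Real.log 4 = Real.log 2 + Real.log 2 := by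
      rw [← Real.log_mul two_ne_zero two_ne_zero]
      norm_num
    linarith
  have hlog2 : 0 < Real.log 2 := Real.log_pos one_lt_two
  have hQL : logHeightAt ξ Q < L := by linarith
  have hndvd : ¬P ∣ Q := by
    rintro ⟨S, rfl⟩
    rw [logHeightAt_mul ξ hP.ne_zero (right_ne_zero_of_mul hQ)] at hQL
    linarith [logHeightAt_nonneg ξ S]
  have hcop : IsCoprime (P.map (Int.castRingHom ℚ)) (Q.map (Int.castRingHom ℚ)) := by
    rw [((IsPrimitive.Int.irreducible_iff_irreducible_map_cast hP).1 hirr).coprime_iff_not_dvd,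
      ← IsPrimitive.Int.dvd_iff_map_cast_dvd_map_cast P Q hP]
    exact hndvd
  have hPξ : Real.log |aeval ξ P| ≤ K - n * L := by
    rw [logDefect] at hPC
    linarith
  have hQξ' : Real.log |aeval ξ Q| ≤ K - n * L := by
    have : (n : ℝ) * (L - K₂ - Real.log 4) ≤ n * Real.log ⌊x⌋₊ := by gcongr
    linarith
  exact ⟨L, hLB.le, exists_real_root_near hn (hξ P hP.ne_zero hPn) (hξ Q hQ hQn) hPn hQn hcop
    le_rfl hQL.le hPξ hQξ' hK3 hLK⟩

lemma exists_prime_dvd_aeval_eq_zero {β : ℝ} (R : ℤ[X]) :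
    R ≠ 0 → aeval β R = 0 → ∃ P, Prime P ∧ P ∣ R ∧ aeval β P = 0 := by
  induction R using UniqueFactorizationMonoid.induction_on_prime with
  | h₁ => exact fun h => absurd rfl h
  | h₂ u hu => exact fun _ h => absurd h (hu.map (aeval β)).ne_zero
  | h₃ R P hR hP ih =>
    intro _ h
    rcases mul_eq_zero.1 ((map_mul (aeval β) P R).symm.trans h) with h | h
    · exact ⟨P, hP, dvd_mul_right P R, h⟩
    · obtain ⟨Q, hQ, hQR, hQβ⟩ := ih hR h
      exact ⟨Q, hQ, hQR.mul_left P, hQβ⟩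

lemma isMinIntPoly_of_irreducible {β : ℝ} {P : ℤ[X]} (hP : Irreducible P)
    (hlc : 0 < P.leadingCoeff) (hβ : aeval β P = 0) : IsMinIntPoly β P := by
  have hdeg : P.natDegree ≠ 0 := by
    intro h0
    rw [eq_C_of_natDegree_eq_zero h0, aeval_C] at hβ
    apply hP.ne_zero
    rw [eq_C_of_natDegree_eq_zero h0, show P.coeff 0 = 0 by simpa using hβ, C_0]
  have hprim := hP.isPrimitive hdeg
  refine ⟨hP.ne_zero, hlc, hprim.content_eq_one, hβ, fun Q hQ hQβ => ?_⟩
  have hdvd : P ∣ Q := by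
    rw [IsPrimitive.Int.dvd_iff_map_cast_dvd_map_cast P Q hprim]
    by_contra h
    obtain ⟨u, v, huv⟩ :=
      ((IsPrimitive.Int.irreducible_iff_irreducible_map_cast hprim).1 hP).coprime_iff_not_dvd.2 h
    have := congrArg (aeval β) huv
    have hmap (S : ℤ[X]) : aeval β (S.map (Int.castRingHom ℚ)) = aeval β S :=
      aeval_map_algebraMap ℚ β S
    rw [map_add, map_mul, map_mul, hmap, hmap, hβ, hQβ, map_one] at this
    simp at this
  exact natDegree_le_of_dvd hdvd hQ

lemma exists_isMinIntPoly (ξ : ℝ) {β : ℝ} {R : ℤ[X]} (hR : R ≠ 0) (hβ : aeval β R = 0) :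
    ∃ P, IsMinIntPoly β P ∧ P.natDegree ≤ R.natDegree ∧ logHeightAt ξ P ≤ logHeightAt ξ R := by
  obtain ⟨P, hP, hPR, hPβ⟩ := exists_prime_dvd_aeval_eq_zero R hR hβ
  obtain ⟨P, hP, hPR, hPβ, hlc⟩ : ∃ P, Prime P ∧ P ∣ R ∧ aeval β P = 0 ∧ 0 < P.leadingCoeff := by
    rcases lt_or_gt_of_ne (leadingCoeff_ne_zero.2 hP.ne_zero) with h | h
    · exact ⟨-P, hP.neg, neg_dvd.2 hPR, by rw [map_neg, hPβ, neg_zero],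
        by rw [leadingCoeff_neg]; linarith⟩
    · exact ⟨P, hP, hPR, hPβ, h⟩
  refine ⟨P, isMinIntPoly_of_irreducible hP.irreducible hlc hPβ, natDegree_le_of_dvd hPR hR, ?_⟩
  obtain ⟨S, rfl⟩ := hPR
  rw [logHeightAt_mul ξ hP.ne_zero (right_ne_zero_of_mul hR)]
  linarith [logHeightAt_nonneg ξ S]

lemma one_le_intPolyHeight {P : ℤ[X]} (hP : P ≠ 0) : 1 ≤ intPolyHeight P := by
  refine le_trans ?_ (Finset.le_sup (f := fun i => (P.coeff i).natAbs)
    (Finset.mem_range.2 (Nat.lt_succ_self P.natDegree)))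
  exact Int.natAbs_pos.2 (leadingCoeff_ne_zero.2 hP)

lemma abs_sub_eq_exp_neg_proximity {ξ β : ℝ} (h : 0 < proximity ξ β) :
    |ξ - β| = Real.exp (-proximity ξ β) := by
  have hn : ‖(ξ : ℂ) - β‖ = |ξ - β| := by
    rw [← Complex.ofReal_sub, Complex.norm_real, Real.norm_eq_abs]
  rw [proximity, hn] at h ⊢
  have hlog : 0 < Real.log |ξ - β|⁻¹ := by
    rw [Real.posLog] at h
    exact (lt_max_iff.1 h).resolve_left (lt_irrefl 0)
  have hpos : 0 < |ξ - β| := by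
    refine (abs_nonneg _).lt_of_ne fun h0 => ?_
    simp [← h0] at hlog
  rw [Real.posLog, max_eq_right hlog.le, Real.log_inv, neg_neg, Real.exp_log hpos]

lemma infinite_of_forall_exists_abs_sub_lt {ξ : ℝ} {S : Set ℝ}
    (h : ∀ ε > 0, ∃ β ∈ S, β ≠ ξ ∧ |ξ - β| < ε) : S.Infinite := by
  intro hfin
  have hU : (S \ {ξ})ᶜ ∈ nhds ξ := (hfin.sdiff.isClosed.isOpen_compl).mem_nhds (by simp)
  obtain ⟨ε, hε, hball⟩ := Metric.mem_nhds_iff.1 hU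
  obtain ⟨β, hβ, hne, hlt⟩ := h ε hε
  refine hball ?_ ⟨hβ, hne⟩
  rwa [Metric.mem_ball, dist_comm, Real.dist_eq]

/-- Wirsing's theorem. -/
theorem wirsing (n : ℕ) (hn : 0 < n) (ξ : ℝ)
    (hξ : ¬ ∃ Q : Polynomial ℚ, Q ≠ 0 ∧ Q.natDegree ≤ n ∧ Polynomial.aeval ξ Q = 0) :
    ∃ c : ℝ, 0 < c ∧
      {α : ℝ | ∃ P : Polynomial ℤ, IsMinIntPoly α P ∧ P.natDegree ≤ n ∧
        |ξ - α| ≤ c * (intPolyHeight P : ℝ) ^ (-(((n : ℝ) + 3) / 2))}.Infinite := by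
  have hξ' : ∀ P : ℤ[X], P ≠ 0 → P.natDegree ≤ n → aeval ξ P ≠ 0 := fun P hP hPn h0 =>
    hξ ⟨P.map (Int.castRingHom ℚ), (Polynomial.map_ne_zero_iff Int.cast_injective).2 hP,
      natDegree_map_le.trans hPn, (aeval_map_algebraMap ℚ ξ P).trans h0⟩
  obtain ⟨K, h⟩ := exists_real_root_proximity_ge hn hξ'
  set D : ℝ := n * Real.log 2 + n * (Real.log 2 + Real.posLog |ξ|) with hD
  refine ⟨Real.exp (2 * K + ((n : ℝ) + 3) / 2 * D), Real.exp_pos _,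
    infinite_of_forall_exists_abs_sub_lt (ξ := ξ) fun ε hε => ?_⟩
  obtain ⟨L, hL, R, hR, hRn, hRL, β, hβ, hprox⟩ := h
    (max 0 (max (4 * K + 1) (4 * K + 1 - 2 * Real.log ε)))
  obtain ⟨hL0, hLK, hLε⟩ : 0 ≤ L ∧ 4 * K + 1 ≤ L ∧ 4 * K + 1 - 2 * Real.log ε ≤ L := by
    simpa only [max_le_iff] using hL
  have hn1 : (1 : ℝ) ≤ n := by exact_mod_cast hn
  have hH := logHeightAt_nonneg ξ R
  have hprox' : L - 4 * K ≤ 2 * proximity ξ β := by nlinarith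
  have hdist := abs_sub_eq_exp_neg_proximity (ξ := ξ) (β := β) (by linarith)
  obtain ⟨P, hP, hPR, hPH⟩ := exists_isMinIntPoly ξ hR hβ
  have hPn := hPR.trans hRn
  refine ⟨β, ⟨P, hP, hPn, ?_⟩, fun h => hξ' R hR hRn (h ▸ hβ), ?_⟩
  · have hpos : (0 : ℝ) < intPolyHeight P := by exact_mod_cast one_le_intPolyHeight hP.1
    have hlog : Real.log (intPolyHeight P) ≤ logHeightAt ξ R + D := by
      have := Real.log_le_log hpos (intPolyHeight_le ξ hPn)
      rw [Real.log_mul (by positivity) (Real.exp_ne_zero _), Real.log_pow, Real.log_exp] at this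
      linarith
    rw [hdist, Real.rpow_def_of_pos hpos, ← Real.exp_add, Real.exp_le_exp]
    have h1 : ((n : ℝ) + 3) / 2 * Real.log (intPolyHeight P) ≤
        ((n : ℝ) + 3) / 2 * (logHeightAt ξ R + D) := by gcongr
    nlinarith
  · rw [hdist, ← Real.lt_log_iff_exp_lt hε]
    linarith
end
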